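/- For all positive integers n, m, k there are only finitely many topological equivalence classes of proper polynomial mappings f : ℂⁿ → ℂᵐ of algebraic degree at most k. -/

import Mathlib

open MvPolynomial

/-! ### Sign-matching of real polynomials under order isomorphisms of the line -/

/-- A strictly monotone map on a finite set of reals extends to an order isomorphism of `ℝ`. -/
theorem exists_orderIso_extending (A : Finset ℝ) (f : ℝ → ℝ) (hf : StrictMonoOn f A) :
    ∃ θ : ℝ ≃o ℝ, ∀ a ∈ A, θ a = f a := by
  classical
  induction A using Finset.induction_on_max with
  | empty => exact ⟨OrderIso.refl ℝ, by simp⟩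
  | insert a A hA ih =>
    obtain ⟨θ, hθ⟩ := ih (hf.mono (by simp))
    obtain ⟨e, he1, he2, he3⟩ : ∃ e : ℝ, e < θ a ∧ e < f a ∧ ∀ b ∈ A, θ b < e := by
      rcases A.eq_empty_or_nonempty with rfl | hne
      · obtain ⟨e, he⟩ := exists_lt (min (θ a) (f a))
        exact ⟨e, he.trans_le (min_le_left _ _), he.trans_le (min_le_right _ _), by simp⟩
      · have hm := A.max'_mem hne
        have h1 : θ (A.max' hne) < θ a := θ.strictMono (hA _ hm)
        have h2 : θ (A.max' hne) < f a := by
          rw [hθ _ hm]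
          exact hf (by simp [hm]) (by simp) (hA _ hm)
        obtain ⟨e, he1, he2⟩ := exists_between (lt_min h1 h2)
        refine ⟨e, he2.trans_le (min_le_left _ _), he2.trans_le (min_le_right _ _), fun b hb => ?_⟩
        exact (θ.monotone (A.le_max' b hb)).trans_lt he1
    set α := (f a - e) / (θ a - e) with hα
    have hαpos : 0 < α := div_pos (by linarith) (by linarith)
    let g : ℝ → ℝ := fun w => if w ≤ e then w else e + (w - e) * α
    have hg : StrictMono g := by
      intro x y hxy
      simp only [g]
      split_ifs with h1 h2 h2
      · exact hxy
      · have := mul_pos (by linarith : 0 < y - e) hαpos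
        linarith
      · linarith
      · have := mul_lt_mul_of_pos_right (by linarith : x - e < y - e) hαpos
        linarith
    have hs : Function.Surjective g := by
      intro y
      by_cases h : y ≤ e
      · exact ⟨y, by simp [g, h]⟩
      · refine ⟨e + (y - e) / α, ?_⟩
        have : 0 < (y - e) / α := div_pos (by linarith) hαpos
        simp only [g]
        rw [if_neg (by linarith)]
        field_simp
        ring
    refine ⟨θ.trans (hg.orderIsoOfSurjective g hs), ?_⟩
    intro b hb
    rcases Finset.mem_insert.1 hb with rfl | hb
    · simp only [OrderIso.trans_apply, StrictMono.coe_orderIsoOfSurjective, g]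
      rw [if_neg (by linarith), hα]
      have : θ b - e ≠ 0 := by linarith
      field_simp
      ring
    · simp only [OrderIso.trans_apply, StrictMono.coe_orderIsoOfSurjective, g]
      rw [if_pos (he3 b hb).le, hθ b hb]

/-- A polynomial without roots on an interval has constant sign there. -/
theorem sign_eval_eq_of_no_root (p : Polynomial ℝ) {a b : ℝ}
    (h : ∀ c ∈ Set.uIcc a b, p.eval c ≠ 0) :
    SignType.sign (p.eval a) = SignType.sign (p.eval b) := by
  have key := intermediate_value_uIcc (a := a) (b := b) (f := fun x => p.eval x)
    p.continuous.continuousOn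
  have h0 : (0 : ℝ) ∉ Set.uIcc (p.eval a) (p.eval b) := fun h0 => by
    obtain ⟨c, hc, hc0⟩ := key h0
    exact h c hc hc0
  rcases lt_trichotomy (p.eval a) 0 with ha | ha | ha
  · rcases lt_or_ge (p.eval b) 0 with hb | hb
    · rw [sign_neg ha, sign_neg hb]
    · exact absurd (Set.mem_uIcc.2 (Or.inl ⟨ha.le, hb⟩)) h0
  · exact absurd ha (h a Set.left_mem_uIcc)
  · rcases lt_or_ge 0 (p.eval b) with hb | hb
    · rw [sign_pos ha, sign_pos hb]
    · exact absurd (Set.mem_uIcc.2 (Or.inr ⟨hb, ha.le⟩)) h0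

/-- `θ` matches the signs of `p` with those of `q`. -/
def SignMatch (θ : ℝ ≃o ℝ) (p q : Polynomial ℝ) : Prop :=
  ∀ w, SignType.sign (p.eval w) = SignType.sign (q.eval (θ w))

theorem SignMatch.symm {θ : ℝ ≃o ℝ} {p q : Polynomial ℝ} (h : SignMatch θ p q) :
    SignMatch θ.symm q p := fun w => by
  rw [h (θ.symm w), θ.apply_symm_apply]

theorem SignMatch.eq_zero_iff {θ : ℝ ≃o ℝ} {p q : Polynomial ℝ} (h : SignMatch θ p q) (w : ℝ) :
    p.eval w = 0 ↔ q.eval (θ w) = 0 := by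
  rw [← sign_eq_zero_iff, h w, sign_eq_zero_iff]

theorem SignMatch.neg {θ : ℝ ≃o ℝ} {p q : Polynomial ℝ} (h : SignMatch θ p q) :
    SignMatch θ (-p) (-q) := fun w => by
  simp [Left.sign_neg, h w]

/-- Sign-matching only depends on the order isomorphism through its values at the roots. -/
theorem SignMatch.congr {θ θ' : ℝ ≃o ℝ} {p q : Polynomial ℝ} (h : SignMatch θ p q)
    (hθ : ∀ w, p.eval w = 0 → θ' w = θ w) : SignMatch θ' p q := by
  intro w
  by_cases hw : p.eval w = 0
  · rw [h w, hθ w hw]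
  rw [h w]
  apply sign_eval_eq_of_no_root
  intro c hc hc0
  have hv : p.eval (θ.symm c) = 0 := by rw [h.eq_zero_iff, θ.apply_symm_apply, hc0]
  have hv' : θ' (θ.symm c) = c := by rw [hθ _ hv, θ.apply_symm_apply]
  have hne : θ.symm c ≠ w := by rintro rfl; exact hw hv
  rcases Set.mem_uIcc.1 hc with ⟨h1, h2⟩ | ⟨h1, h2⟩
  · have a1 : w ≤ θ.symm c := by rwa [θ.le_symm_apply]
    have a2 : θ' (θ.symm c) ≤ θ' w := by rwa [hv']
    exact hne (le_antisymm (θ'.le_iff_le.1 a2) a1)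
  · have a1 : θ.symm c ≤ w := by rwa [θ.symm_apply_le]
    have a2 : θ' w ≤ θ' (θ.symm c) := by rwa [hv']
    exact hne (le_antisymm a1 (θ'.le_iff_le.1 a2))

theorem exists_pos_of_derivative_pos (p : Polynomial ℝ) (hp : 0 < p.natDegree) (a : ℝ)
    (h : ∀ w, a ≤ w → 0 < p.derivative.eval w) : ∃ b, a < b ∧ 0 < p.eval b := by
  have hdeg : 0 < p.degree := Polynomial.natDegree_pos_iff_degree_pos.1 hp
  rcases le_or_gt 0 p.leadingCoeff with hl | hl
  · have := p.tendsto_atTop_of_leadingCoeff_nonneg hdeg hl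
    obtain ⟨b, hb1, hb2⟩ := ((this.eventually_gt_atTop 0).and (Filter.eventually_gt_atTop a)).exists
    exact ⟨b, hb2, hb1⟩
  · exfalso
    have := p.tendsto_atBot_of_leadingCoeff_nonpos hdeg hl.le
    obtain ⟨b, hb1, hb2⟩ :=
      ((this.eventually_lt_atBot (p.eval a)).and (Filter.eventually_gt_atTop a)).exists
    have hm : MonotoneOn (fun x => p.eval x) (Set.Ici a) := by
      apply monotoneOn_of_deriv_nonneg (convex_Ici a) p.continuous.continuousOn
        p.differentiable.differentiableOn
      intro x hx
      rw [interior_Ici] at hx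
      rw [Polynomial.deriv]
      exact (h x (le_of_lt hx)).le
    have := hm (Set.self_mem_Ici) (Set.mem_Ici.2 hb2.le) hb2.le
    simp only at this
    linarith

theorem exists_derivative_eq_zero_between (p : Polynomial ℝ) {a b : ℝ} (hab : a < b)
    (ha : p.eval a = 0) (hb : p.eval b = 0) :
    ∃ c, a < c ∧ c < b ∧ p.derivative.eval c = 0 := by
  obtain ⟨c, hc, h⟩ := exists_deriv_eq_zero hab p.continuous.continuousOn (ha.trans hb.symm)
  exact ⟨c, hc.1, hc.2, by rw [← Polynomial.deriv]; exact h⟩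

/-- Conjugation of an order isomorphism of `ℝ` by the reflection at the origin. -/
noncomputable def reflectIso (θ : ℝ ≃o ℝ) : ℝ ≃o ℝ :=
  StrictMono.orderIsoOfRightInverse (fun w => -θ (-w))
    (fun a b hab => neg_lt_neg (θ.strictMono (neg_lt_neg hab))) (fun w => -θ.symm (-w))
    (fun w => by simp)

@[simp] theorem reflectIso_apply (θ : ℝ ≃o ℝ) (w : ℝ) : reflectIso θ w = -θ (-w) := rfl

/-- A nonconstant real polynomial has a root or a critical point. -/
theorem no_root_free {p : Polynomial ℝ} (hp : 0 < p.natDegree) (h0 : ∀ c, p.eval c ≠ 0)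
    (h1 : ∀ c, p.derivative.eval c ≠ 0) : False := by
  have key : ∀ r : Polynomial ℝ, 0 < r.natDegree → (∀ c, r.eval c ≠ 0) →
      (∀ c, 0 < r.derivative.eval c) → False := by
    intro r hr h0 h1
    obtain ⟨b, -, hb⟩ := exists_pos_of_derivative_pos r hr 0 fun w _ => h1 w
    obtain ⟨c, -, hc⟩ := exists_pos_of_derivative_pos (-(r.comp (-Polynomial.X)))
      (by simpa [Polynomial.natDegree_comp] using hr) 0
      (fun w _ => by simpa [Polynomial.derivative_comp] using h1 (-w))
    have hs := sign_eval_eq_of_no_root r (a := b) (b := -c) fun d _ => h0 d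
    have hc' : r.eval (-c) < 0 := by simpa using hc
    rw [sign_pos hb, sign_neg hc'] at hs
    exact absurd hs (by decide)
  have hs : ∀ c, SignType.sign (p.derivative.eval 0) = SignType.sign (p.derivative.eval c) :=
    fun c => sign_eval_eq_of_no_root _ fun d _ => h1 d
  rcases lt_or_gt_of_ne (h1 0) with h | h
  · refine key (-p) (by simpa using hp) (by simpa using h0) fun c => ?_
    have := hs c
    rw [sign_neg h, eq_comm, sign_eq_neg_one_iff] at this
    simpa using this
  · refine key p hp h0 fun c => ?_
    have := hs c
    rwa [sign_pos h, eq_comm, sign_eq_one_iff] at this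

section Step

variable {θ : ℝ ≃o ℝ} {p q : Polynomial ℝ} {Z : Finset ℝ}

theorem exists_matched_root_right (hd : SignMatch θ p.derivative q.derivative)
    (hZ : ∀ w, p.derivative.eval w = 0 → w ∈ Z)
    (hs : ∀ z ∈ Z, SignType.sign (p.eval z) = SignType.sign (q.eval (θ z)))
    (hq : 0 < q.natDegree) {u : ℝ} (hu : p.eval u = 0)
    (hpos : 0 < p.derivative.eval u) (hneg : q.eval (θ u) < 0) :
    ∃ v, θ u ≤ v ∧ q.eval v = 0 ∧ ∀ z ∈ Z, u < z → v < θ z := by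
  classical
  rcases (Z.filter (u < ·)).eq_empty_or_nonempty with he | hne
  · have hno : ∀ z ∈ Z, ¬ u < z := by
      intro z hz huz
      have : z ∈ Z.filter (u < ·) := Finset.mem_filter.2 ⟨hz, huz⟩
      simp [he] at this
    have hpd : ∀ w, θ u ≤ w → 0 < q.derivative.eval w := by
      intro w hw
      have h1 : u ≤ θ.symm w := by rwa [θ.le_symm_apply]
      have h2 := hd (θ.symm w)
      rw [θ.apply_symm_apply] at h2
      rw [← sign_eq_one_iff, ← h2, sign_eq_one_iff, ← sign_eq_one_iff,
        ← sign_eval_eq_of_no_root (a := u), sign_eq_one_iff]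
      · exact hpos
      · intro c hc h0
        rw [Set.uIcc_of_le h1] at hc
        rcases hc.1.eq_or_lt with rfl | h
        · exact hpos.ne' h0
        · exact hno c (hZ c h0) h
    obtain ⟨b, hb, hb0⟩ := exists_pos_of_derivative_pos q hq (θ u) hpd
    obtain ⟨v, hv, hv0⟩ := intermediate_value_Icc hb.le (f := fun x => q.eval x)
      q.continuous.continuousOn ⟨hneg.le, hb0.le⟩
    exact ⟨v, hv.1, hv0, fun z hz huz => absurd huz (hno z hz)⟩
  · set z := (Z.filter (u < ·)).min' hne
    have hz := Finset.mem_filter.1 ((Z.filter (u < ·)).min'_mem hne)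
    have hmin : ∀ c ∈ Z, u < c → z ≤ c := fun c hc huc =>
      Finset.min'_le _ _ (Finset.mem_filter.2 ⟨hc, huc⟩)
    have hmono : StrictMonoOn (fun x => p.eval x) (Set.Icc u z) := by
      apply strictMonoOn_of_deriv_pos (convex_Icc u z) p.continuous.continuousOn
      intro x hx
      rw [interior_Icc] at hx
      rw [Polynomial.deriv, ← sign_eq_one_iff, ← sign_eval_eq_of_no_root (a := u), sign_eq_one_iff]
      · exact hpos
      · intro c hc h0
        rw [Set.uIcc_of_le hx.1.le] at hc
        rcases hc.1.eq_or_lt with rfl | h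
        · exact hpos.ne' h0
        · exact (hc.2.trans_lt hx.2).not_ge (hmin c (hZ c h0) h)
    have hpz : 0 < p.eval z := by
      have := hmono (Set.left_mem_Icc.2 hz.2.le) (Set.right_mem_Icc.2 hz.2.le) hz.2
      simpa [hu] using this
    have hqz : 0 < q.eval (θ z) := by
      rw [← sign_eq_one_iff, ← hs z hz.1, sign_eq_one_iff]; exact hpz
    obtain ⟨v, hv, hv0⟩ := intermediate_value_Ioo (θ.monotone hz.2.le) (f := fun x => q.eval x)
      q.continuous.continuousOn ⟨hneg, hqz⟩
    exact ⟨v, hv.1.le, hv0, fun c hc huc => hv.2.trans_le (θ.monotone (hmin c hc huc))⟩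

theorem exists_matched_root_of_pos (hd : SignMatch θ p.derivative q.derivative)
    (hZ : ∀ w, p.derivative.eval w = 0 → w ∈ Z)
    (hs : ∀ z ∈ Z, SignType.sign (p.eval z) = SignType.sign (q.eval (θ z)))
    (hq : 0 < q.natDegree) {u : ℝ} (hu : p.eval u = 0)
    (hpos : 0 < p.derivative.eval u) :
    ∃ v, q.eval v = 0 ∧ ∀ z ∈ Z, (u < z → v < θ z) ∧ (z < u → θ z < v) := by
  classical
  rcases lt_trichotomy (q.eval (θ u)) 0 with h | h | h
  · obtain ⟨v, h1, h2, h3⟩ := exists_matched_root_right hd hZ hs hq hu hpos h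
    exact ⟨v, h2, fun z hz => ⟨h3 z hz, fun hzu => (θ.strictMono hzu).trans_le h1⟩⟩
  · exact ⟨θ u, h, fun z hz => ⟨fun h => θ.strictMono h, fun h => θ.strictMono h⟩⟩
  · have hderiv : ∀ (r : Polynomial ℝ) (w : ℝ), (-(r.comp (-Polynomial.X))).derivative.eval w =
        r.derivative.eval (-w) := by
      intro r w
      simp [Polynomial.derivative_comp]
    have hd' : SignMatch (reflectIso θ) (-(p.comp (-Polynomial.X))).derivative
        (-(q.comp (-Polynomial.X))).derivative := by
      intro w
      rw [hderiv, hderiv, hd (-w)]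
      simp
    obtain ⟨v, h1, h2, h3⟩ := exists_matched_root_right (θ := reflectIso θ)
      (p := -(p.comp (-Polynomial.X))) (q := -(q.comp (-Polynomial.X)))
      (Z := Z.image (fun x => -x)) hd'
      (fun w hw => by
        rw [hderiv] at hw
        exact Finset.mem_image.2 ⟨-w, hZ _ hw, neg_neg w⟩)
      (fun z hz => by
        obtain ⟨y, hy, rfl⟩ := Finset.mem_image.1 hz
        simp [Left.sign_neg, hs y hy])
      (by simpa [Polynomial.natDegree_comp] using hq) (u := -u) (by simp [hu])
      (by rw [hderiv]; simpa using hpos) (by simpa using h)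
    simp only [reflectIso_apply, neg_neg] at h1
    refine ⟨-v, by simpa using h2, fun z hz => ⟨fun huz => ?_, fun hzu => ?_⟩⟩
    · have := θ.strictMono huz
      linarith
    · have := h3 (-z) (Finset.mem_image_of_mem _ hz) (neg_lt_neg hzu)
      simp only [reflectIso_apply, neg_neg] at this
      linarith

theorem exists_matched_root (hd : SignMatch θ p.derivative q.derivative)
    (hZ : ∀ w, p.derivative.eval w = 0 → w ∈ Z)
    (hs : ∀ z ∈ Z, SignType.sign (p.eval z) = SignType.sign (q.eval (θ z)))
    (hq : 0 < q.natDegree) {u : ℝ} (hu : p.eval u = 0) (huZ : u ∉ Z) :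
    ∃ v, q.eval v = 0 ∧ ∀ z ∈ Z, (u < z → v < θ z) ∧ (z < u → θ z < v) := by
  rcases lt_trichotomy (p.derivative.eval u) 0 with h | h | h
  · obtain ⟨v, h1, h2⟩ := exists_matched_root_of_pos (p := -p) (q := -q) (θ := θ) (Z := Z)
      (by simpa using hd.neg) (fun w hw => hZ w (by simpa using hw))
      (fun z hz => by simp [Left.sign_neg, hs z hz]) (by simpa using hq) (u := u)
      (by simpa using hu) (by simpa using h)
    exact ⟨v, by simpa using h1, h2⟩
  · exact absurd (hZ u h) huZ
  · exact exists_matched_root_of_pos hd hZ hs hq hu h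

/-- If the signs of the derivatives are matched, and the signs of `p` and `q` at a set of points
containing the critical points are matched, then the matching can be changed off this set so that
it matches the signs of `p` and `q`. -/
theorem exists_signMatch_of_derivative (hd : SignMatch θ p.derivative q.derivative)
    (hZ : ∀ w, p.derivative.eval w = 0 → w ∈ Z)
    (hs : ∀ z ∈ Z, SignType.sign (p.eval z) = SignType.sign (q.eval (θ z)))
    (hp : 0 < p.natDegree) (hq : 0 < q.natDegree) :
    ∃ θ' : ℝ ≃o ℝ, (∀ z ∈ Z, θ' z = θ z) ∧ SignMatch θ' p q := by
  classical
  have hp0 : p ≠ 0 := by rintro rfl; simp at hp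
  have hq0 : q ≠ 0 := by rintro rfl; simp at hq
  have hqZ : ∀ w, q.derivative.eval w = 0 → θ.symm w ∈ Z := fun w hw =>
    hZ _ (by rw [hd.eq_zero_iff, θ.apply_symm_apply, hw])
  have hM := fun (u : ℝ) (h : p.eval u = 0 ∧ u ∉ Z) => exists_matched_root hd hZ hs hq h.1 h.2
  choose v hv hvZ using hM
  let f : ℝ → ℝ := fun u => if h : p.eval u = 0 ∧ u ∉ Z then v u h else θ u
  have hfZ : ∀ z ∈ Z, f z = θ z := fun z hz => by simp [f, hz]
  have hfr : ∀ u, p.eval u = 0 → q.eval (f u) = 0 := by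
    intro u hu
    by_cases h : u ∈ Z
    · rw [hfZ u h, ← sign_eq_zero_iff, ← hs u h, sign_eq_zero_iff, hu]
    · simp only [f, dif_pos (⟨hu, h⟩ : p.eval u = 0 ∧ u ∉ Z)]
      exact hv _ _
  have hflt : ∀ u z, p.eval u = 0 → u ∉ Z → z ∈ Z → (u < z → f u < θ z) ∧ (z < u → θ z < f u) := by
    intro u z hu huZ hz
    simp only [f, dif_pos (⟨hu, huZ⟩ : p.eval u = 0 ∧ u ∉ Z)]
    exact hvZ _ _ z hz
  have hmono : StrictMonoOn f ((Z ∪ p.roots.toFinset : Finset ℝ) : Set ℝ) := by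
    intro a ha b hb hab
    have key : ∀ c ∈ (Z ∪ p.roots.toFinset : Finset ℝ), c ∈ Z ∨ (p.eval c = 0 ∧ c ∉ Z) := by
      intro c hc
      by_cases h : c ∈ Z
      · exact Or.inl h
      · right
        rcases Finset.mem_union.1 hc with hc | hc
        · exact absurd hc h
        · rw [Multiset.mem_toFinset, Polynomial.mem_roots hp0] at hc
          exact ⟨hc, h⟩
    rcases key a ha with ha | ⟨ha, haZ⟩ <;> rcases key b hb with hb | ⟨hb, hbZ⟩
    · rw [hfZ a ha, hfZ b hb]; exact θ.strictMono hab
    · rw [hfZ a ha]; exact (hflt b a hb hbZ ha).2 hab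
    · rw [hfZ b hb]; exact (hflt a b ha haZ hb).1 hab
    · obtain ⟨c, hac, hcb, hc⟩ := exists_derivative_eq_zero_between p hab ha hb
      exact ((hflt a c ha haZ (hZ c hc)).1 hac).trans ((hflt b c hb hbZ (hZ c hc)).2 hcb)
  obtain ⟨θ', hθ'⟩ := exists_orderIso_extending _ f hmono
  have hθ'Z : ∀ z ∈ Z, θ' z = θ z := fun z hz => by
    rw [hθ' z (Finset.mem_union_left _ hz), hfZ z hz]
  refine ⟨θ', hθ'Z, ?_⟩
  have hd' : SignMatch θ' p.derivative q.derivative := hd.congr fun w hw => hθ'Z w (hZ w hw)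
  -- roots correspond
  have hroot : ∀ u, p.eval u = 0 → q.eval (θ' u) = 0 := fun u hu => by
    rw [hθ' u (Finset.mem_union_right _ (by simp [hp0, hu]))]
    exact hfr u hu
  have hroot' : ∀ w, q.eval w = 0 → p.eval (θ'.symm w) = 0 := by
    intro w hw
    by_cases hwZ : θ.symm w ∈ Z
    · have h1 : θ' (θ.symm w) = w := by rw [hθ'Z _ hwZ, θ.apply_symm_apply]
      have h2 : θ'.symm w = θ.symm w := by rw [θ'.symm_apply_eq, h1]
      rw [h2, ← sign_eq_zero_iff, hs _ hwZ, θ.apply_symm_apply, hw, sign_zero]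
    · obtain ⟨u, hu, huZ⟩ := exists_matched_root (θ := θ.symm) (p := q) (q := p)
        (Z := Z.image θ) hd.symm
        (fun w hw => Finset.mem_image.2 ⟨_, hqZ w hw, θ.apply_symm_apply w⟩)
        (fun z hz => by
          obtain ⟨y, hy, rfl⟩ := Finset.mem_image.1 hz
          rw [θ.symm_apply_apply, hs y hy])
        hp (u := w) hw
        (fun h => by
          obtain ⟨y, hy, rfl⟩ := Finset.mem_image.1 h
          rw [θ.symm_apply_apply] at hwZ
          exact hwZ hy)
      have huw : θ' u = w := by
        by_contra hne
        rcases lt_or_gt_of_ne hne with h | h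
        · obtain ⟨c, h1, h2, hc⟩ := exists_derivative_eq_zero_between q h (hroot u hu) hw
          have hcZ := hqZ c hc
          have e1 := (huZ _ (Finset.mem_image_of_mem θ hcZ)).2
          rw [θ.apply_symm_apply] at e1
          have e2 := θ'.strictMono (e1 h2)
          rw [hθ'Z _ hcZ, θ.apply_symm_apply] at e2
          exact lt_asymm e2 h1
        · obtain ⟨c, h1, h2, hc⟩ := exists_derivative_eq_zero_between q h hw (hroot u hu)
          have hcZ := hqZ c hc
          have e1 := (huZ _ (Finset.mem_image_of_mem θ hcZ)).1
          rw [θ.apply_symm_apply] at e1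
          have e2 := θ'.strictMono (e1 h1)
          rw [hθ'Z _ hcZ, θ.apply_symm_apply] at e2
          exact lt_asymm e2 h2
      rw [← huw, θ'.symm_apply_apply, hu]
  have hcrit : ∀ w, q.derivative.eval w = 0 → p.derivative.eval (θ'.symm w) = 0 := fun w hw => by
    rw [hd'.eq_zero_iff, θ'.apply_symm_apply, hw]
  intro w
  by_cases hpw : p.eval w = 0
  · rw [hpw, hroot w hpw]
  by_cases hwZ : w ∈ Z
  · rw [hs w hwZ, hθ'Z w hwZ]
  rcases (Z ∪ p.roots.toFinset).eq_empty_or_nonempty with he | hne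
  · exfalso
    have hno : ∀ c, p.eval c ≠ 0 := fun c hc => by
      have : c ∈ Z ∪ p.roots.toFinset := Finset.mem_union_right _ (by simp [hp0, hc])
      simp [he] at this
    have hZe : ∀ c, p.derivative.eval c ≠ 0 := fun c hc => by
      have : c ∈ Z ∪ p.roots.toFinset := Finset.mem_union_left _ (hZ c hc)
      simp [he] at this
    exact no_root_free hp hno hZe
  obtain ⟨a, ha, hmin⟩ := Finset.exists_min_image _ (fun a => |a - w|) hne
  have hmin' : ∀ c ∈ Z ∪ p.roots.toFinset, ¬ (a < c ∧ c ≤ w) ∧ ¬ (w ≤ c ∧ c < a) := by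
    intro c hc
    have h1 := hmin c hc
    constructor
    · rintro ⟨h2, h3⟩
      rw [abs_of_nonpos (by linarith), abs_of_nonpos (by linarith)] at h1
      linarith
    · rintro ⟨h2, h3⟩
      rw [abs_of_nonneg (by linarith), abs_of_nonneg (by linarith)] at h1
      linarith
  have haw : a ≠ w := by
    rintro rfl
    rcases Finset.mem_union.1 ha with h | h
    · exact hwZ h
    · rw [Multiset.mem_toFinset, Polynomial.mem_roots hp0] at h
      exact hpw h
  by_cases hpa : p.eval a = 0
  · have hqa := hroot a hpa
    rcases lt_or_gt_of_ne haw with h | h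
    · obtain ⟨c, hc, hc'⟩ := exists_deriv_eq_slope (fun x => p.eval x) h
        p.continuous.continuousOn p.differentiable.differentiableOn
      obtain ⟨d, hd1, hd2⟩ := exists_deriv_eq_slope (fun x => q.eval x) (θ'.strictMono h)
        q.continuous.continuousOn q.differentiable.differentiableOn
      rw [Polynomial.deriv, hpa, sub_zero, eq_div_iff (by linarith)] at hc'
      rw [Polynomial.deriv, hqa, sub_zero, eq_div_iff
        (sub_ne_zero.2 (θ'.strictMono h).ne')] at hd2
      rw [← hc', ← hd2, sign_mul, sign_mul, sign_pos (by linarith : 0 < w - a),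
        sign_pos (sub_pos.2 (θ'.strictMono h)), mul_one, mul_one, hd' c]
      apply sign_eval_eq_of_no_root
      intro e he he0
      have hes := hmin' _ (Finset.mem_union_left _ (hZ _ (hcrit e he0)))
      have h1 : θ' a < e ∧ e < θ' w := by
        have := θ'.strictMono hc.1
        have := θ'.strictMono hc.2
        rcases Set.mem_uIcc.1 he with h | h
        · exact ⟨by linarith, by linarith [hd1.2]⟩
        · exact ⟨by linarith [hd1.1], by linarith⟩
      exact hes.1 ⟨by rw [θ'.lt_symm_apply]; exact h1.1, by rw [θ'.symm_apply_le]; exact h1.2.le⟩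
    · obtain ⟨c, hc, hc'⟩ := exists_deriv_eq_slope (fun x => p.eval x) h
        p.continuous.continuousOn p.differentiable.differentiableOn
      obtain ⟨d, hd1, hd2⟩ := exists_deriv_eq_slope (fun x => q.eval x) (θ'.strictMono h)
        q.continuous.continuousOn q.differentiable.differentiableOn
      rw [Polynomial.deriv, hpa, zero_sub, eq_div_iff (by linarith)] at hc'
      rw [Polynomial.deriv, hqa, zero_sub, eq_div_iff
        (sub_ne_zero.2 (θ'.strictMono h).ne')] at hd2
      have e1 : p.eval w = -(p.derivative.eval c * (a - w)) := by rw [hc', neg_neg]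
      have e2 : q.eval (θ' w) = -(q.derivative.eval d * (θ' a - θ' w)) := by rw [hd2, neg_neg]
      rw [e1, e2, Left.sign_neg, Left.sign_neg, sign_mul, sign_mul,
        sign_pos (by linarith : 0 < a - w),
        sign_pos (sub_pos.2 (θ'.strictMono h)), mul_one, mul_one, hd' c]
      congr 1
      apply sign_eval_eq_of_no_root
      intro e he he0
      have hes := hmin' _ (Finset.mem_union_left _ (hZ _ (hcrit e he0)))
      have h1 : θ' w < e ∧ e < θ' a := by
        have := θ'.strictMono hc.1
        have := θ'.strictMono hc.2
        rcases Set.mem_uIcc.1 he with h | h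
        · exact ⟨by linarith, by linarith [hd1.2]⟩
        · exact ⟨by linarith [hd1.1], by linarith⟩
      exact hes.2 ⟨by rw [θ'.le_symm_apply]; exact h1.1.le, by rw [θ'.symm_apply_lt]; exact h1.2⟩
  · have haZ : a ∈ Z := by
      rcases Finset.mem_union.1 ha with h | h
      · exact h
      · rw [Multiset.mem_toFinset, Polynomial.mem_roots hp0] at h
        exact absurd h hpa
    have hbet : ∀ c ∈ Set.uIcc a w, p.eval c ≠ 0 := by
      intro c hc hc0
      have hcA : c ∈ Z ∪ p.roots.toFinset := Finset.mem_union_right _ (by simp [hp0, hc0])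
      have hac : a ≠ c := by rintro rfl; exact hpa hc0
      rcases Set.mem_uIcc.1 hc with h | h
      · exact (hmin' c hcA).1 ⟨lt_of_le_of_ne h.1 hac, h.2⟩
      · exact (hmin' c hcA).2 ⟨h.1, lt_of_le_of_ne h.2 hac.symm⟩
    rw [← sign_eval_eq_of_no_root p hbet, hs a haZ, ← hθ'Z a haZ]
    apply sign_eval_eq_of_no_root
    intro c hc hc0
    refine hbet (θ'.symm c) ?_ (hroot' c hc0)
    rcases Set.mem_uIcc.1 hc with h | h
    · exact Set.mem_uIcc.2 (Or.inl ⟨by rw [θ'.le_symm_apply]; exact h.1,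
        by rw [θ'.symm_apply_le]; exact h.2⟩)
    · exact Set.mem_uIcc.2 (Or.inr ⟨by rw [θ'.le_symm_apply]; exact h.1,
        by rw [θ'.symm_apply_le]; exact h.2⟩)

end Step

/-! ### Elimination of one real variable -/

/-- Pseudo-division with remainder over a commutative ring. -/
theorem exists_pseudo_division {R : Type*} [CommRing R] (q : Polynomial R) {e : ℕ}
    (hq : q.natDegree ≤ e) (p : Polynomial R) :
    ∃ (k : ℕ) (s r : Polynomial R),
      Polynomial.C (q.coeff e) ^ k * p = q * s + r ∧ r.degree < e := by
  suffices H : ∀ (N : ℕ) (p : Polynomial R), p.degree < N → ∃ (k : ℕ) (s r : Polynomial R),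
      Polynomial.C (q.coeff e) ^ k * p = q * s + r ∧ r.degree < e by
    exact H (p.natDegree + 1) p (by
      rw [Polynomial.degree_lt_iff_coeff_zero]
      intro m hm
      exact Polynomial.coeff_eq_zero_of_natDegree_lt (by omega))
  intro N
  induction N with
  | zero =>
    intro p hp
    have : p = 0 := by
      rw [← Polynomial.degree_eq_bot]
      simpa using hp
    exact ⟨0, 0, 0, by simp [this], by simp⟩
  | succ N ih =>
    intro p hp
    rcases lt_or_ge N e with hNe | hNe
    · exact ⟨0, 0, p, by simp, hp.trans_le (by exact_mod_cast hNe)⟩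
    obtain ⟨k, s, r, h1, h2⟩ := ih
      (Polynomial.C (q.coeff e) * p - Polynomial.C (p.coeff N) * (Polynomial.X ^ (N - e) * q)) (by
      rw [Polynomial.degree_lt_iff_coeff_zero] at hp ⊢
      intro m hm
      rw [Polynomial.coeff_sub, Polynomial.coeff_C_mul, Polynomial.coeff_C_mul,
        Polynomial.coeff_X_pow_mul', if_pos (by omega)]
      rcases hm.eq_or_lt with rfl | hm
      · rw [show N - (N - e) = e by omega]; ring
      · have : q.natDegree < m - (N - e) := by omega
        rw [hp m hm, Polynomial.coeff_eq_zero_of_natDegree_lt this]; ring)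
    refine ⟨k + 1, s + Polynomial.C (q.coeff e) ^ k * Polynomial.C (p.coeff N) *
      Polynomial.X ^ (N - e), r, ?_, h2⟩
    linear_combination h1

/-- The part of `q` of degree at most `e`. -/
noncomputable def truncate {R : Type*} [CommRing R] (q : Polynomial R) (e : ℕ) : Polynomial R :=
  ∑ i ∈ Finset.range (e + 1), Polynomial.monomial i (q.coeff i)

theorem truncate_coeff {R : Type*} [CommRing R] (q : Polynomial R) (e i : ℕ) :
    (truncate q e).coeff i = if i ≤ e then q.coeff i else 0 := by
  simp [truncate, Polynomial.coeff_monomial]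

theorem truncate_natDegree_le {R : Type*} [CommRing R] (q : Polynomial R) (e : ℕ) :
    (truncate q e).natDegree ≤ e := by
  rw [Polynomial.natDegree_le_iff_coeff_eq_zero]
  intro i hi
  rw [truncate_coeff, if_neg (by omega)]

theorem truncate_map_eq {R K : Type*} [CommRing R] [CommRing K] (φ : R →+* K) (q : Polynomial R)
    {e : ℕ} (he : (q.map φ).natDegree ≤ e) : (truncate q e).map φ = q.map φ := by
  ext i
  rw [Polynomial.coeff_map, truncate_coeff]
  split_ifs with h
  · rw [Polynomial.coeff_map]
  · rw [map_zero, Polynomial.coeff_eq_zero_of_natDegree_lt (by omega)]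

/-- Two real points of a ring have the same signs on a finite set. -/
def SignAgree {R : Type*} [CommRing R] (G : Set R) (φ ψ : R →+* ℝ) : Prop :=
  ∀ a ∈ G, SignType.sign (φ a) = SignType.sign (ψ a)

theorem SignAgree.mono {R : Type*} [CommRing R] {G H : Set R} {φ ψ : R →+* ℝ}
    (h : SignAgree H φ ψ) (hGH : G ⊆ H) : SignAgree G φ ψ := fun a ha => h a (hGH ha)

theorem natDegree_map_eq_of_sign {R : Type*} [CommRing R] {φ ψ : R →+* ℝ} {p : Polynomial R}
    (h : ∀ i, SignType.sign (φ (p.coeff i)) = SignType.sign (ψ (p.coeff i))) :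
    (p.map φ).natDegree = (p.map ψ).natDegree := by
  have key : ∀ φ ψ : R →+* ℝ, (∀ i, SignType.sign (φ (p.coeff i)) = SignType.sign (ψ (p.coeff i))) →
      (p.map φ).natDegree ≤ (p.map ψ).natDegree := by
    intro φ ψ h
    rw [Polynomial.natDegree_le_iff_coeff_eq_zero]
    intro i hi
    rw [Polynomial.coeff_map, ← sign_eq_zero_iff, h, sign_eq_zero_iff, ← Polynomial.coeff_map]
    exact Polynomial.coeff_eq_zero_of_natDegree_lt hi
  exact le_antisymm (key φ ψ h) (key ψ φ fun i => (h i).symm)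

/-- The set of all coefficients of a finite set of polynomials. -/
noncomputable def allCoeffs {R : Type*} [CommRing R] (F : Finset (Polynomial R)) : Finset R := by
  classical
  exact F.biUnion fun p => (Finset.range (p.natDegree + 1)).image p.coeff

theorem SignAgree.coeff {R : Type*} [CommRing R] {φ ψ : R →+* ℝ} {F : Finset (Polynomial R)}
    (h : SignAgree (allCoeffs F : Set R) φ ψ) {p : Polynomial R} (hp : p ∈ F) (i : ℕ) :
    SignType.sign (φ (p.coeff i)) = SignType.sign (ψ (p.coeff i)) := by
  classical
  by_cases hi : i ≤ p.natDegree
  · apply h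
    simp only [allCoeffs, Finset.coe_biUnion, Set.mem_iUnion]
    exact ⟨p, hp, by
      simp only [Finset.coe_image, Set.mem_image, Finset.coe_range, Set.mem_Iio]
      exact ⟨i, by omega, rfl⟩⟩
  · rw [Polynomial.coeff_eq_zero_of_natDegree_lt (by omega)]
    simp

/-- A finite set of elements determines the order of the roots of a family of polynomials. -/
def Eliminates {R : Type*} [CommRing R] (F : Finset (Polynomial R)) (G : Finset R) : Prop :=
  ∀ φ ψ : R →+* ℝ, SignAgree (G : Set R) φ ψ →
    ∃ θ : ℝ ≃o ℝ, ∀ p ∈ F, SignMatch θ (p.map φ) (p.map ψ)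

theorem exists_eliminates_insert {R : Type*} [CommRing R] (d : ℕ) (F : Finset (Polynomial R))
    (p : Polynomial R) (hp : p.natDegree = d + 1) (hF : ∀ q ∈ F, q.natDegree ≤ d + 1)
    (ih : ∀ F₀ : Finset (Polynomial R), (∀ q ∈ F₀, q.natDegree ≤ d) →
      ∃ G, Eliminates (by classical exact F ∪ F₀) G) :
    ∃ G, Eliminates (by classical exact insert p F) G := by
  classical
  have hdiv : ∀ (q : Polynomial R) (e : ℕ), ∃ (k : ℕ) (s r : Polynomial R),
      Polynomial.C (q.coeff e) ^ (2 * k) * p = truncate q e * s + r ∧ r.degree < e := by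
    intro q e
    obtain ⟨k, s, r, h1, h2⟩ := exists_pseudo_division (truncate q e) (truncate_natDegree_le q e) p
    rw [truncate_coeff, if_pos le_rfl] at h1
    refine ⟨k, Polynomial.C (q.coeff e) ^ k * s, Polynomial.C (q.coeff e) ^ k * r, ?_, ?_⟩
    · rw [two_mul, pow_add]; linear_combination Polynomial.C (q.coeff e) ^ k * h1
    · rw [← Polynomial.C_pow]
      rw [Polynomial.degree_lt_iff_coeff_zero] at h2 ⊢
      intro m hm
      rw [Polynomial.coeff_C_mul, h2 m hm, mul_zero]
  choose k s r hr hrdeg using hdiv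
  set E := insert p.derivative F with hE
  set Rem := E.biUnion fun q => (Finset.Icc 1 (d + 1)).image (r q) with hRem
  have hpd : p.derivative.natDegree ≤ d := by
    have := Polynomial.natDegree_derivative_le p
    omega
  obtain ⟨G, hG⟩ := ih (insert p.derivative Rem) (by
    intro q hq
    rcases Finset.mem_insert.1 hq with rfl | hq
    · exact hpd
    · simp only [hRem, Finset.mem_biUnion, Finset.mem_image, Finset.mem_Icc] at hq
      obtain ⟨a, -, e, he, rfl⟩ := hq
      rw [Polynomial.natDegree_le_iff_coeff_eq_zero]
      intro i hi
      exact (Polynomial.degree_lt_iff_coeff_zero _ _).1 (hrdeg a e) i (by omega))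
  refine ⟨G ∪ allCoeffs (insert p E), fun φ ψ h => ?_⟩
  have hGag : SignAgree (G : Set R) φ ψ := h.mono (by simp)
  have hco : SignAgree (allCoeffs (insert p E) : Set R) φ ψ := h.mono (by simp)
  obtain ⟨θ, hθ⟩ := hG φ ψ hGag
  have hpE : p ∈ insert p E := Finset.mem_insert_self _ _
  have hpdeg := natDegree_map_eq_of_sign (hco.coeff hpE)
  rcases Nat.eq_zero_or_pos (p.map φ).natDegree with h0 | hpos
  · refine ⟨θ, fun q hq => ?_⟩
    rcases Finset.mem_insert.1 hq with rfl | hq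
    · intro w
      rw [Polynomial.eq_C_of_natDegree_eq_zero h0, Polynomial.eq_C_of_natDegree_eq_zero
        (hpdeg.symm.trans h0), Polynomial.eval_C, Polynomial.eval_C, Polynomial.coeff_map,
        Polynomial.coeff_map]
      exact hco.coeff hpE 0
    · exact hθ q (Finset.mem_union_left _ hq)
  have hEθ : ∀ q ∈ E, SignMatch θ (q.map φ) (q.map ψ) := by
    intro q hq
    apply hθ
    rcases Finset.mem_insert.1 hq with rfl | hq
    · exact Finset.mem_union_right _ (Finset.mem_insert_self _ _)
    · exact Finset.mem_union_left _ hq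
  have hEdeg : ∀ q ∈ E, q.natDegree ≤ d + 1 := by
    intro q hq
    rcases Finset.mem_insert.1 hq with rfl | hq
    · omega
    · exact hF q hq
  set Z : Finset ℝ := E.biUnion fun q => (q.map φ).roots.toFinset with hZ
  have hZmem : ∀ q ∈ E, q.map φ ≠ 0 → ∀ w, (q.map φ).eval w = 0 → w ∈ Z := by
    intro q hq hq0 w hw
    exact Finset.mem_biUnion.2 ⟨q, hq, by
      rw [Multiset.mem_toFinset, Polynomial.mem_roots hq0]; exact hw⟩
  obtain ⟨θ', hθ'Z, hθ'⟩ := exists_signMatch_of_derivative (θ := θ) (p := p.map φ) (q := p.map ψ)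
    (Z := Z)
    (by
      rw [Polynomial.derivative_map, Polynomial.derivative_map]
      exact hEθ _ (Finset.mem_insert_self _ _))
    (by
      intro w hw
      rw [Polynomial.derivative_map] at hw
      refine hZmem _ (Finset.mem_insert_self _ _) ?_ w hw
      rw [← Polynomial.derivative_map]
      intro h
      have := Polynomial.derivative_eq_zero.1 h
      omega)
    (by
      intro z hz
      obtain ⟨q, hq, hzq⟩ := Finset.mem_biUnion.1 hz
      rw [Multiset.mem_toFinset] at hzq
      have hq0 : q.map φ ≠ 0 := by rintro h; simp [h] at hzq
      rw [Polynomial.mem_roots hq0] at hzq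
      have hqE : q ∈ insert p E := Finset.mem_insert_of_mem hq
      have hqdeg := natDegree_map_eq_of_sign (hco.coeff hqE)
      set e := (q.map φ).natDegree with he
      have he1 : 1 ≤ e := by
        by_contra hlt
        have he0 : (q.map φ).natDegree = 0 := by omega
        rw [Polynomial.eq_C_of_natDegree_eq_zero he0] at hzq hq0
        simp at hzq
        rw [Polynomial.coeff_map, hzq] at hq0
        simp at hq0
      have hed : e ≤ d + 1 := Polynomial.natDegree_map_le.trans (hEdeg q hq)
      have ha : φ (q.coeff e) ≠ 0 := by
        rw [← Polynomial.coeff_map, he]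
        exact Polynomial.leadingCoeff_ne_zero.2 hq0
      have hb : ψ (q.coeff e) ≠ 0 := by
        rw [Ne, ← sign_eq_zero_iff, ← hco.coeff hqE e, sign_eq_zero_iff]; exact ha
      have key : ∀ (χ : R →+* ℝ) (w : ℝ), (q.map χ).natDegree ≤ e → χ (q.coeff e) ≠ 0 →
          (q.map χ).eval w = 0 →
          SignType.sign ((p.map χ).eval w) = SignType.sign (((r q e).map χ).eval w) := by
        intro χ w h1 h2 h3
        have := congrArg (fun t => (t.map χ).eval w) (hr q e)
        simp only [Polynomial.map_mul, Polynomial.map_pow, Polynomial.map_C, Polynomial.map_add,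
          Polynomial.eval_mul, Polynomial.eval_pow, Polynomial.eval_C, Polynomial.eval_add,
          truncate_map_eq χ q h1, h3, zero_mul, zero_add] at this
        have hpos : 0 < χ (q.coeff e) ^ (2 * k q e) := by
          rw [pow_mul]
          positivity
        rw [← this, sign_mul, sign_pos hpos, one_mul]
      rw [key φ z le_rfl ha hzq, key ψ (θ z) hqdeg.ge hb (((hEθ q hq).eq_zero_iff z).1 hzq)]
      apply hθ
      refine Finset.mem_union_right _ (Finset.mem_insert_of_mem ?_)
      exact Finset.mem_biUnion.2 ⟨q, hq, Finset.mem_image.2 ⟨e, Finset.mem_Icc.2 ⟨he1, hed⟩, rfl⟩⟩)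
    hpos (hpdeg ▸ hpos)
  refine ⟨θ', fun q hq => ?_⟩
  rcases Finset.mem_insert.1 hq with rfl | hq
  · exact hθ'
  · have hqE : q ∈ E := Finset.mem_insert_of_mem hq
    by_cases hq0 : q.map φ = 0
    · have := hEθ q hqE
      intro w
      rw [this w]
      have h0 : ∀ w, (q.map ψ).eval w = 0 := fun w => by
        have h1 := (this.eq_zero_iff (θ.symm w)).1 (by simp [hq0])
        rwa [θ.apply_symm_apply] at h1
      rw [h0, h0]
    · exact (hEθ q hqE).congr fun w hw => hθ'Z w (hZmem q hqE hq0 w hw)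

/-- **Cohen–Hörmander elimination**: the order type of the roots, and the signs in between, of a
finite family of polynomials are determined by the signs of finitely many elements of the
coefficient ring. -/
theorem exists_eliminates {R : Type*} [CommRing R] (F : Finset (Polynomial R)) :
    ∃ G, Eliminates F G := by
  classical
  suffices H : ∀ (d : ℕ) (F : Finset (Polynomial R)), (∀ q ∈ F, q.natDegree ≤ d) →
      ∃ G, Eliminates F G from
    H (F.sup Polynomial.natDegree) F fun q hq => Finset.le_sup (f := Polynomial.natDegree) hq
  intro d
  induction d with
  | zero =>
    intro F hF
    refine ⟨allCoeffs F, fun φ ψ h => ⟨OrderIso.refl ℝ, fun p hp w => ?_⟩⟩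
    rw [Polynomial.eq_C_of_natDegree_le_zero (hF p hp)]
    simpa using h.coeff hp 0
  | succ d ih =>
    suffices H : ∀ (T F₀ : Finset (Polynomial R)), (∀ q ∈ T, q.natDegree = d + 1) →
        (∀ q ∈ F₀, q.natDegree ≤ d) → ∃ G, Eliminates (T ∪ F₀) G by
      intro F hF
      have := H (F.filter (·.natDegree = d + 1)) (F.filter (¬ ·.natDegree = d + 1))
        (fun q hq => (Finset.mem_filter.1 hq).2) (fun q hq => by
          have := Finset.mem_filter.1 hq
          have := hF q this.1
          omega)
      rwa [Finset.filter_union_filter_not_eq] at this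
    intro T
    induction T using Finset.induction_on with
    | empty => intro F₀ _ h; simpa using ih F₀ h
    | insert p T hpT ihT =>
      intro F₀ hT hF₀
      rw [Finset.insert_union]
      have := exists_eliminates_insert d (T ∪ F₀) p (hT p (Finset.mem_insert_self _ _))
        (by
          intro q hq
          rcases Finset.mem_union.1 hq with hq | hq
          · exact (hT q (Finset.mem_insert_of_mem hq)).le
          · exact (hF₀ q hq).trans (Nat.le_succ d))
        (by
          intro F₁ hF₁
          rw [Finset.union_assoc]
          exact ihT (F₀ ∪ F₁) (fun q hq => hT q (Finset.mem_insert_of_mem hq)) (by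
            intro q hq
            rcases Finset.mem_union.1 hq with hq | hq
            · exact hF₀ q hq
            · exact hF₁ q hq))
      convert this

theorem eval₂Hom_cons {R K : Type*} [CommRing R] [CommRing K] (φ : R →+* K) {n : ℕ} (w : K)
    (x : Fin n → K) (P : MvPolynomial (Fin (n + 1)) R) :
    eval₂Hom φ (Fin.cons w x : Fin (n + 1) → K) P =
      ((finSuccEquiv R n P).map (eval₂Hom φ x)).eval w := by
  induction P using MvPolynomial.induction_on with
  | C a => simp [finSuccEquiv_apply]
  | add p q hp hq => simp only [map_add, hp, hq, Polynomial.map_add, Polynomial.eval_add]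
  | mul_X p i hp =>
    rw [map_mul, hp, map_mul, Polynomial.map_mul, Polynomial.eval_mul]
    congr 1
    refine Fin.cases ?_ (fun j => ?_) i
    · simp [finSuccEquiv_X_zero]
    · simp [finSuccEquiv_X_succ]

/-- Elimination of several real variables. -/
theorem exists_eliminates_mv {R : Type*} [CommRing R] (n : ℕ)
    (H : Finset (MvPolynomial (Fin n) R)) :
    ∃ G : Finset R, ∀ φ ψ : R →+* ℝ, SignAgree (G : Set R) φ ψ → ∀ x : Fin n → ℝ,
      ∃ x' : Fin n → ℝ, SignAgree (H : Set (MvPolynomial (Fin n) R))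
        (eval₂Hom φ x) (eval₂Hom ψ x') := by
  classical
  induction n with
  | zero =>
    refine ⟨H.image (isEmptyRingEquiv R (Fin 0)), fun φ ψ h x => ⟨x, fun P hP => ?_⟩⟩
    have hPC : P = C (isEmptyRingEquiv R (Fin 0) P) :=
      ((isEmptyRingEquiv R (Fin 0)).symm_apply_apply P).symm
    rw [hPC]
    simp only [coe_eval₂Hom, eval₂_C]
    exact h _ (by simpa using ⟨P, hP, rfl⟩)
  | succ n ih =>
    obtain ⟨G₁, hG₁⟩ := exists_eliminates (H.image (finSuccEquiv R n))
    obtain ⟨G, hG⟩ := ih G₁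
    refine ⟨G, fun φ ψ h x => ?_⟩
    obtain ⟨x', hx'⟩ := hG φ ψ h (Fin.tail x)
    obtain ⟨θ, hθ⟩ := hG₁ _ _ hx'
    refine ⟨Fin.cons (θ (x 0)) x', fun P hP => ?_⟩
    rw [← Fin.cons_self_tail x, eval₂Hom_cons, eval₂Hom_cons]
    exact hθ _ (Finset.mem_image_of_mem _ hP) (x 0)

/-! ### Thom's lemma -/

/-- The closed sign condition obtained by relaxing a strict one. -/
def WeakSign (t : SignType) (v : ℝ) : Prop := (0 ≤ t → 0 ≤ v) ∧ (t ≤ 0 → v ≤ 0)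

theorem weakSign_sign (v : ℝ) : WeakSign (SignType.sign v) v :=
  ⟨sign_nonneg_iff.1, sign_nonpos_iff.1⟩

theorem WeakSign.of_mem_uIcc {t : SignType} {a b c : ℝ} (ha : WeakSign t a) (hb : WeakSign t b)
    (hc : c ∈ Set.uIcc a b) : WeakSign t c := by
  rcases Set.mem_uIcc.1 hc with h | h
  · exact ⟨fun ht => (ha.1 ht).trans h.1, fun ht => h.2.trans (hb.2 ht)⟩
  · exact ⟨fun ht => (hb.1 ht).trans h.1, fun ht => h.2.trans (ha.2 ht)⟩

theorem WeakSign.of_tendsto {α : Type*} {l : Filter α} [l.NeBot] {t : SignType} {f : α → ℝ} {v : ℝ}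
    (hf : Filter.Tendsto f l (nhds v)) (h : ∀ᶠ x in l, SignType.sign (f x) = t) : WeakSign t v :=
  ⟨fun ht => ge_of_tendsto hf (h.mono fun _ hx => sign_nonneg_iff.1 (hx ▸ ht)),
    fun ht => le_of_tendsto hf (h.mono fun _ hx => sign_nonpos_iff.1 (hx ▸ ht))⟩

theorem WeakSign.of_sign_eq {t : SignType} {a b : ℝ} (h : WeakSign t a)
    (hab : SignType.sign a = SignType.sign b) : WeakSign t b :=
  ⟨fun ht => by rw [← sign_nonneg_iff, ← hab, sign_nonneg_iff]; exact h.1 ht,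
    fun ht => by rw [← sign_nonpos_iff, ← hab, sign_nonpos_iff]; exact h.2 ht⟩

theorem eval_mem_uIcc_of_derivative_weakSign (p : Polynomial ℝ) {a b : ℝ} {t : SignType}
    (h : ∀ c ∈ Set.Icc a b, WeakSign t (p.derivative.eval c)) {c : ℝ} (hc : c ∈ Set.Icc a b) :
    p.eval c ∈ Set.uIcc (p.eval a) (p.eval b) := by
  have hab : a ≤ b := hc.1.trans hc.2
  rcases le_total 0 t with ht | ht
  · have hm : MonotoneOn (fun x => p.eval x) (Set.Icc a b) := by
      apply monotoneOn_of_deriv_nonneg (convex_Icc a b) p.continuous.continuousOn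
        p.differentiable.differentiableOn
      intro x hx
      rw [Polynomial.deriv]
      exact (h x (interior_subset hx)).1 ht
    exact Set.mem_uIcc.2 (Or.inl ⟨hm (Set.left_mem_Icc.2 hab) hc hc.1,
      hm hc (Set.right_mem_Icc.2 hab) hc.2⟩)
  · have hm : AntitoneOn (fun x => p.eval x) (Set.Icc a b) := by
      apply antitoneOn_of_deriv_nonpos (convex_Icc a b) p.continuous.continuousOn
        p.differentiable.differentiableOn
      intro x hx
      rw [Polynomial.deriv]
      exact (h x (interior_subset hx)).2 ht
    exact Set.mem_uIcc.2 (Or.inr ⟨hm hc (Set.right_mem_Icc.2 hab) hc.2,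
      hm (Set.left_mem_Icc.2 hab) hc hc.1⟩)

/-- **Thom's lemma**: weak sign conditions on a family closed under derivatives
define convex sets. -/
theorem weakSign_of_mem_Icc {ι : Type*} {p : ι → Polynomial ℝ}
    (hp : ∀ i, ∃ j, p j = (p i).derivative) {τ : ι → SignType} {a b : ℝ}
    (ha : ∀ i, WeakSign (τ i) ((p i).eval a)) (hb : ∀ i, WeakSign (τ i) ((p i).eval b))
    (i : ι) {c : ℝ} (hc : c ∈ Set.Icc a b) : WeakSign (τ i) ((p i).eval c) := by
  suffices H : ∀ (d : ℕ) (i : ι), (p i).natDegree ≤ d → ∀ c ∈ Set.Icc a b,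
      WeakSign (τ i) ((p i).eval c) from H _ i le_rfl c hc
  intro d
  induction d with
  | zero =>
    intro i hi c hc
    have := ha i
    rw [Polynomial.eq_C_of_natDegree_le_zero hi] at this ⊢
    simpa using this
  | succ d ih =>
    intro i hi c hc
    obtain ⟨j, hj⟩ := hp i
    have hjd : (p j).natDegree ≤ d := by
      rw [hj]
      have := Polynomial.natDegree_derivative_le (p i)
      omega
    exact (ha i).of_mem_uIcc (hb i)
      (eval_mem_uIcc_of_derivative_weakSign (p i) (t := τ j) (hj ▸ ih j hjd) hc)

theorem eq_of_weakSign {ι : Type*} {p : ι → Polynomial ℝ}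
    (hp : ∀ i, ∃ j, p j = (p i).derivative) {τ : ι → SignType} {a b : ℝ}
    (ha : ∀ i, WeakSign (τ i) ((p i).eval a)) (hb : ∀ i, WeakSign (τ i) ((p i).eval b))
    {i : ι} (h0 : p i ≠ 0) (hi : τ i = 0) : a = b := by
  by_contra hne
  wlog hab : a < b generalizing a b
  · exact this hb ha (Ne.symm hne) (lt_of_le_of_ne (not_lt.1 hab) (Ne.symm hne))
  refine h0 (Polynomial.eq_zero_of_infinite_isRoot _ ((Set.Icc_infinite hab).mono fun c hc => ?_))
  have := weakSign_of_mem_Icc hp ha hb i hc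
  rw [hi] at this
  exact le_antisymm (this.2 le_rfl) (this.1 le_rfl)

/-! ### Piecewise linear interpolation -/

/-- The largest element of `A` not exceeding `t`. -/
noncomputable def lowerNbr (A : Set ℝ) (t : ℝ) : ℝ := sSup {a ∈ A | a ≤ t}

/-- The smallest element of `A` exceeding `t`. -/
noncomputable def upperNbr (A : Set ℝ) (t : ℝ) : ℝ := sInf {a ∈ A | t < a}

/-- Piecewise linear interpolation of `g` on `A`. -/
noncomputable def plInterp (A : Set ℝ) (g : ℝ → ℝ) (t : ℝ) : ℝ :=
  g (lowerNbr A t) + (t - lowerNbr A t) / (upperNbr A t - lowerNbr A t) *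
    (g (upperNbr A t) - g (lowerNbr A t))

section Interp

variable {A : Set ℝ} {c d t : ℝ}

theorem lowerNbr_spec (hA : A.Finite) (hc : c ∈ A) (ht : c ≤ t) :
    lowerNbr A t ∈ A ∧ lowerNbr A t ≤ t :=
  Set.Nonempty.csSup_mem (s := {a ∈ A | a ≤ t}) ⟨c, hc, ht⟩ (hA.subset fun _ h => h.1)

theorem le_lowerNbr {a : ℝ} (ha : a ∈ A) (hat : a ≤ t) : a ≤ lowerNbr A t :=
  le_csSup ⟨t, fun _ h => h.2⟩ ⟨ha, hat⟩

theorem upperNbr_spec (hA : A.Finite) (hd : d ∈ A) (ht : t < d) :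
    upperNbr A t ∈ A ∧ t < upperNbr A t :=
  Set.Nonempty.csInf_mem (s := {a ∈ A | t < a}) ⟨d, hd, ht⟩ (hA.subset fun _ h => h.1)

theorem upperNbr_le {a : ℝ} (ha : a ∈ A) (hat : t < a) : upperNbr A t ≤ a :=
  csInf_le ⟨t, fun _ h => h.2.le⟩ ⟨ha, hat⟩

theorem plInterp_mem {g : ℝ → ℝ} (hA : A.Finite) (hc : c ∈ A) (hd : d ∈ A)
    (hg : StrictMonoOn g A) (ht : t ∈ Set.Ico c d) :
    g (lowerNbr A t) ≤ plInterp A g t ∧ plInterp A g t < g (upperNbr A t) := by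
  obtain ⟨h1, h2⟩ := lowerNbr_spec hA hc ht.1
  obtain ⟨h3, h4⟩ := upperNbr_spec hA hd ht.2
  have h5 := hg h1 h3 (h2.trans_lt h4)
  have h6 : 0 < upperNbr A t - lowerNbr A t := by linarith
  have h7 : (t - lowerNbr A t) / (upperNbr A t - lowerNbr A t) < 1 := by
    rw [div_lt_one h6]; linarith
  have h8 : 0 ≤ (t - lowerNbr A t) / (upperNbr A t - lowerNbr A t) :=
    div_nonneg (by linarith) h6.le
  constructor
  · have := mul_nonneg h8 (sub_nonneg.2 h5.le)
    unfold plInterp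
    linarith
  · have := mul_lt_mul_of_pos_right h7 (sub_pos.2 h5)
    unfold plInterp
    linarith

theorem plInterp_strictMonoOn {g : ℝ → ℝ} (hA : A.Finite) (hc : c ∈ A) (hd : d ∈ A)
    (hg : StrictMonoOn g A) : StrictMonoOn (plInterp A g) (Set.Ico c d) := by
  intro s hs t ht hst
  obtain ⟨h1, h2⟩ := lowerNbr_spec hA hc hs.1
  obtain ⟨h3, h4⟩ := upperNbr_spec hA hd hs.2
  obtain ⟨k1, k2⟩ := lowerNbr_spec hA hc ht.1
  obtain ⟨k3, k4⟩ := upperNbr_spec hA hd ht.2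
  have h5 := hg h1 h3 (h2.trans_lt h4)
  rcases lt_or_ge t (upperNbr A s) with h | h
  · have e1 : lowerNbr A t = lowerNbr A s := by
      apply le_antisymm
      · apply le_lowerNbr k1
        by_contra hlt
        exact (upperNbr_le k1 (not_le.1 hlt)).not_gt (k2.trans_lt h)
      · exact le_lowerNbr h1 (h2.trans hst.le)
    have e2 : upperNbr A t = upperNbr A s :=
      le_antisymm (upperNbr_le h3 h) (upperNbr_le k3 (hst.trans k4))
    unfold plInterp
    rw [e1, e2]
    have h6 : 0 < upperNbr A s - lowerNbr A s := by linarith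
    have := mul_lt_mul_of_pos_right
      (div_lt_div_of_pos_right (sub_lt_sub_right hst (lowerNbr A s)) h6) (sub_pos.2 h5)
    linarith
  · refine ((plInterp_mem hA hc hd hg hs).2.trans_le ?_).trans_le
      (plInterp_mem hA hc hd hg ht).1
    exact hg.monotoneOn h3 k1 (le_lowerNbr h3 h)

theorem plInterp_surjOn {g : ℝ → ℝ} (hA : A.Finite) (hc : c ∈ A) (hd : d ∈ A)
    (hg : StrictMonoOn g A) {y : ℝ} (hy : y ∈ Set.Ico (g c) (g d)) :
    ∃ t ∈ Set.Ico c d, plInterp A g t = y := by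
  obtain ⟨⟨a, ha, haa⟩, h2⟩ := lowerNbr_spec (hA.image g) (Set.mem_image_of_mem g hc) hy.1
  obtain ⟨⟨b, hb, hbb⟩, h4⟩ := upperNbr_spec (hA.image g) (Set.mem_image_of_mem g hd) hy.2
  rw [← haa] at h2
  rw [← hbb] at h4
  have hab : a < b := (hg.lt_iff_lt ha hb).1 (h2.trans_lt h4)
  have hsep : ∀ x ∈ A, x ≤ a ∨ b ≤ x := by
    intro x hx
    rcases le_or_gt (g x) y with h | h
    · left
      have := le_lowerNbr (Set.mem_image_of_mem g hx) h
      rw [← haa] at this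
      exact (hg.le_iff_le hx ha).1 this
    · right
      have := upperNbr_le (Set.mem_image_of_mem g hx) h
      rw [← hbb] at this
      exact (hg.le_iff_le hb hx).1 this
  have h5 : 0 < g b - g a := by linarith
  have h7 : (y - g a) / (g b - g a) < 1 := by
    rw [div_lt_one h5]; linarith
  have h8 : 0 ≤ (y - g a) / (g b - g a) := div_nonneg (by linarith) h5.le
  set t := a + (y - g a) / (g b - g a) * (b - a) with ht
  have hat : a ≤ t := by
    have := mul_nonneg h8 (sub_nonneg.2 hab.le)
    linarith
  have htb : t < b := by
    have := mul_lt_mul_of_pos_right h7 (sub_pos.2 hab)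
    linarith
  have hca : c ≤ a := by
    rcases hsep c hc with h | h
    · exact h
    · exact absurd ((hg.le_iff_le hb hc).2 h) (by linarith [hy.1])
  have hbd : b ≤ d := by
    rcases hsep d hd with h | h
    · exact absurd ((hg.le_iff_le hd ha).2 h) (by linarith [hy.2])
    · exact h
  refine ⟨t, ⟨hca.trans hat, htb.trans_le hbd⟩, ?_⟩
  have e1 : lowerNbr A t = a := by
    apply le_antisymm
    · obtain ⟨k1, k2⟩ := lowerNbr_spec hA hc (hca.trans hat)
      exact (hsep _ k1).resolve_right fun h => by linarith
    · exact le_lowerNbr ha hat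
  have e2 : upperNbr A t = b := by
    apply le_antisymm
    · exact upperNbr_le hb htb
    · obtain ⟨k1, k2⟩ := upperNbr_spec hA hd (htb.trans_le hbd)
      exact (hsep _ k1).resolve_left fun h => by linarith
  unfold plInterp
  rw [e1, e2, ht]
  have : b - a ≠ 0 := by linarith
  field_simp
  ring

end Interp

theorem plInterp_of_mem {A : Set ℝ} {g : ℝ → ℝ} {a : ℝ} (ha : a ∈ A) :
    plInterp A g a = g a := by
  have : lowerNbr A a = a :=
    le_antisymm (csSup_le ⟨a, ha, le_rfl⟩ fun _ h => h.2) (le_lowerNbr ha le_rfl)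
  unfold plInterp
  rw [this]
  simp

open Real in
/-- The set of interpolation nodes in the compactified line. -/
noncomputable def interpNodes (Z : Set ℝ) : Set ℝ :=
  insert (-(π / 2)) (insert (π / 2) (arctan '' Z))

open Real in
/-- The extension of an order isomorphism to the compactified line. -/
noncomputable def compactified (θ : ℝ ≃o ℝ) (t : ℝ) : ℝ :=
  if t ∈ Set.Ioo (-(π / 2)) (π / 2) then arctan (θ (tan t)) else t

section Compactified

open Real

theorem compactified_arctan (θ : ℝ ≃o ℝ) (w : ℝ) :
    compactified θ (arctan w) = arctan (θ w) := by
  rw [compactified, if_pos (arctan_mem_Ioo w), tan_arctan]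

theorem compactified_left (θ : ℝ ≃o ℝ) : compactified θ (-(π / 2)) = -(π / 2) := by
  simp [compactified]

theorem compactified_right (θ : ℝ ≃o ℝ) : compactified θ (π / 2) = π / 2 := by
  simp [compactified]

theorem compactified_strictMonoOn (θ : ℝ ≃o ℝ) (Z : Set ℝ) :
    StrictMonoOn (compactified θ) (interpNodes Z) := by
  have hpi := pi_pos
  intro a ha b hb hab
  rcases ha with rfl | rfl | ⟨ζ, -, rfl⟩ <;> rcases hb with rfl | rfl | ⟨ξ, -, rfl⟩
  · exact absurd hab (lt_irrefl _)
  · rw [compactified_left, compactified_right]; exact hab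
  · rw [compactified_left, compactified_arctan]; exact neg_pi_div_two_lt_arctan _
  · linarith
  · exact absurd hab (lt_irrefl _)
  · exact absurd hab (arctan_lt_pi_div_two _).not_gt
  · exact absurd hab (neg_pi_div_two_lt_arctan _).not_gt
  · rw [compactified_right, compactified_arctan]; exact arctan_lt_pi_div_two _
  · rw [compactified_arctan, compactified_arctan]
    exact arctan_strictMono (θ.strictMono (arctan_strictMono.lt_iff_lt.1 hab))

theorem interpNodes_finite {Z : Set ℝ} (hZ : Z.Finite) : (interpNodes Z).Finite :=
  ((hZ.image _).insert _).insert _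

theorem plInterp_compactified_mem {Z : Set ℝ} (hZ : Z.Finite) (θ : ℝ ≃o ℝ) {t : ℝ}
    (ht : t ∈ Set.Ioo (-(π / 2)) (π / 2)) :
    plInterp (interpNodes Z) (compactified θ) t ∈ Set.Ioo (-(π / 2)) (π / 2) := by
  have hA := interpNodes_finite hZ
  have hc : -(π / 2) ∈ interpNodes Z := Or.inl rfl
  have hd : π / 2 ∈ interpNodes Z := Or.inr (Or.inl rfl)
  have hg := compactified_strictMonoOn θ Z
  constructor
  · have h1 := plInterp_strictMonoOn hA hc hd hg
      ⟨le_rfl, ht.1.trans ht.2⟩ ⟨ht.1.le, ht.2⟩ ht.1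
    rwa [plInterp_of_mem hc, compactified_left] at h1
  · have h1 := (plInterp_mem hA hc hd hg ⟨ht.1.le, ht.2⟩).2
    have h2 := upperNbr_spec hA hd ht.2
    have h3 := hg.monotoneOn h2.1 hd (upperNbr_le hd ht.2)
    rw [compactified_right] at h3
    exact h1.trans_le h3

/-- An order isomorphism of `ℝ` can be replaced by one which depends canonically on its restriction
to a finite set. -/
theorem exists_interpIso {Z : Set ℝ} (hZ : Z.Finite) (θ : ℝ ≃o ℝ) :
    ∃ φ : ℝ ≃o ℝ, (∀ w, φ w = tan (plInterp (interpNodes Z) (compactified θ) (arctan w))) ∧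
      ∀ ζ ∈ Z, φ ζ = θ ζ := by
  have hA := interpNodes_finite hZ
  have hc : -(π / 2) ∈ interpNodes Z := Or.inl rfl
  have hd : π / 2 ∈ interpNodes Z := Or.inr (Or.inl rfl)
  have hg := compactified_strictMonoOn θ Z
  have hmem := fun w => plInterp_compactified_mem hZ θ (arctan_mem_Ioo w)
  let f : ℝ → ℝ := fun w => tan (plInterp (interpNodes Z) (compactified θ) (arctan w))
  have hf : StrictMono f := by
    intro a b hab
    have h1 := arctan_mem_Ioo a
    have h2 := arctan_mem_Ioo b
    exact strictMonoOn_tan (hmem a) (hmem b)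
      (plInterp_strictMonoOn hA hc hd hg ⟨h1.1.le, h1.2⟩ ⟨h2.1.le, h2.2⟩ (arctan_strictMono hab))
  have hs : Function.Surjective f := by
    intro y
    have hy := arctan_mem_Ioo y
    obtain ⟨t, ht, hty⟩ := plInterp_surjOn hA hc hd hg (y := arctan y) (by
      rw [compactified_left, compactified_right]
      exact ⟨hy.1.le, hy.2⟩)
    have ht0 : t ≠ -(π / 2) := by
      rintro rfl
      rw [plInterp_of_mem hc, compactified_left] at hty
      rw [← hty] at hy
      exact lt_irrefl _ hy.1
    refine ⟨tan t, ?_⟩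
    simp only [f]
    rw [arctan_tan (lt_of_le_of_ne ht.1 ht0.symm) ht.2, hty, tan_arctan]
  refine ⟨hf.orderIsoOfSurjective f hs, fun w => rfl, fun ζ hζ => ?_⟩
  have : arctan ζ ∈ interpNodes Z := Or.inr (Or.inr ⟨ζ, hζ, rfl⟩)
  simp only [StrictMono.coe_orderIsoOfSurjective, f]
  rw [plInterp_of_mem this, compactified_arctan, tan_arctan]

end Compactified

/-! ### Continuous dependence of the interpolated isomorphisms -/

/-- A family of polynomials with coefficients depending continuously on a parameter and with
constant degrees, closed under derivatives. -/
structure GoodFamily {X ι : Type*} [TopologicalSpace X] (p : ι → X → Polynomial ℝ) : Prop where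
  cont : ∀ i n, Continuous fun x => (p i x).coeff n
  deg : ∀ i x y, (p i x).degree = (p i y).degree
  der : ∀ i, ∃ j, ∀ x, p j x = (p i x).derivative

namespace GoodFamily

/-- The roots of the nonzero members of the family. -/
def rootSet {X ι : Type*} (p : ι → X → Polynomial ℝ) (x : X) : Set ℝ := {w | ∃ i, p i x ≠ 0 ∧ (p i x).eval w = 0}

theorem rootSet_finite {X ι : Type*} [Finite ι] (p : ι → X → Polynomial ℝ) (x : X) : (rootSet p x).Finite := by
  have : rootSet p x ⊆ ⋃ i, ((p i x).roots.toFinset : Set ℝ) := by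
    rintro w ⟨i, h0, hw⟩
    refine Set.mem_iUnion.2 ⟨i, ?_⟩
    simp [h0, hw]
  exact (Set.finite_iUnion fun i => Finset.finite_toSet _).subset this

variable {X ι : Type*} [TopologicalSpace X] {p q : ι → X → Polynomial ℝ}

theorem natDegree_eq (hp : GoodFamily p) (i : ι) (x y : X) :
    (p i x).natDegree = (p i y).natDegree :=
  Polynomial.natDegree_eq_of_degree_eq (hp.deg i x y)

theorem eq_zero_iff (hp : GoodFamily p) (i : ι) (x y : X) : p i x = 0 ↔ p i y = 0 := by
  rw [← Polynomial.degree_eq_bot, ← Polynomial.degree_eq_bot, hp.deg i x y]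

theorem continuous_eval (hp : GoodFamily p) (i : ι) :
    Continuous fun z : X × ℝ => (p i z.1).eval z.2 := by
  rcases isEmpty_or_nonempty X with hX | ⟨⟨x₀⟩⟩
  · exact continuous_iff_continuousAt.2 fun z => isEmptyElim z.1
  have : (fun z : X × ℝ => (p i z.1).eval z.2) = fun z : X × ℝ =>
      ∑ n ∈ Finset.range ((p i x₀).natDegree + 1), (p i z.1).coeff n * z.2 ^ n := by
    ext z
    rw [Polynomial.eval_eq_sum_range, hp.natDegree_eq i z.1 x₀]
  rw [this]
  exact continuous_finsetSum _ fun n _ =>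
    ((hp.cont i n).comp continuous_fst).mul (continuous_snd.pow n)

theorem continuous_cauchyBound (hp : GoodFamily p) (i : ι) :
    Continuous fun x => (p i x).cauchyBound := by
  rcases isEmpty_or_nonempty X with hX | ⟨⟨x₀⟩⟩
  · exact continuous_iff_continuousAt.2 fun z => isEmptyElim z
  by_cases h0 : p i x₀ = 0
  · have : ∀ x, p i x = 0 := fun x => (hp.eq_zero_iff i x₀ x).1 h0
    simp only [this]
    exact continuous_const
  have : (fun x => (p i x).cauchyBound) = fun x =>
      (Finset.range (p i x₀).natDegree).sup (fun n => ‖(p i x).coeff n‖₊) /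
        ‖(p i x).coeff (p i x₀).natDegree‖₊ + 1 := by
    ext x
    rw [Polynomial.cauchyBound, Polynomial.leadingCoeff, hp.natDegree_eq i x x₀]
  rw [this]
  refine (Continuous.div₀ ?_ (hp.cont i _).nnnorm fun x => ?_).add continuous_const
  · exact Continuous.finset_sup_apply fun n _ => (hp.cont i n).nnnorm
  · rw [nnnorm_ne_zero_iff, hp.natDegree_eq i x₀ x]
    exact Polynomial.leadingCoeff_ne_zero.2 ((hp.eq_zero_iff i x₀ x).not.1 h0)

/-- Roots have limits along ultrafilters. -/
theorem exists_tendsto_of_root (hp : GoodFamily p) (i : ι) {x₀ : X} (h0 : p i x₀ ≠ 0)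
    {𝒰 : Ultrafilter X} (h𝒰 : (𝒰 : Filter X) ≤ nhds x₀) {ζ : X → ℝ}
    (hζ : ∀ᶠ x in (𝒰 : Filter X), (p i x).eval (ζ x) = 0) :
    ∃ ξ, Filter.Tendsto ζ 𝒰 (nhds ξ) := by
  set B : ℝ := (p i x₀).cauchyBound + 1
  have hB : ∀ᶠ x in (𝒰 : Filter X), ((p i x).cauchyBound : ℝ) < B := by
    have : Filter.Tendsto (fun x => ((p i x).cauchyBound : ℝ)) 𝒰
        (nhds ((p i x₀).cauchyBound : ℝ)) :=
      ((NNReal.continuous_coe.comp (hp.continuous_cauchyBound i)).tendsto x₀).mono_left h𝒰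
    exact this.eventually_lt_const (by simp [B])
  have hmem : ∀ᶠ x in (𝒰 : Filter X), ζ x ∈ Metric.closedBall (0 : ℝ) B := by
    filter_upwards [hζ, hB] with x hx hxB
    have := Polynomial.IsRoot.norm_lt_cauchyBound ((hp.eq_zero_iff i x₀ x).not.1 h0) hx
    rw [mem_closedBall_zero_iff]
    exact (lt_trans (by exact_mod_cast this) hxB).le
  obtain ⟨ξ, -, hξ⟩ := (isCompact_closedBall (0 : ℝ) B).ultrafilter_le_nhds (𝒰.map ζ)
    (Filter.le_principal_iff.2 hmem)
  exact ⟨ξ, hξ⟩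

theorem tendsto_eval (hp : GoodFamily p) (i : ι) {x₀ : X} {l : Filter X} (hl : l ≤ nhds x₀)
    {ζ : X → ℝ} {ξ : ℝ} (hζ : Filter.Tendsto ζ l (nhds ξ)) :
    Filter.Tendsto (fun x => (p i x).eval (ζ x)) l (nhds ((p i x₀).eval ξ)) :=
  ((hp.continuous_eval i).tendsto (x₀, ξ)).comp
    ((Filter.tendsto_id'.2 hl).prodMk_nhds hζ)

theorem exists_root_near [Finite ι] (hp : GoodFamily p) {x₀ : X} {ξ : ℝ} (hξ : ξ ∈ rootSet p x₀)
    {ε : ℝ} (hε : 0 < ε) : ∀ᶠ x in nhds x₀, ∃ ζ ∈ rootSet p x, |ζ - ξ| < ε := by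
  classical
  -- choose a member of least degree vanishing at `ξ`
  obtain ⟨j, ⟨hj0, hjξ⟩, hmin⟩ : ∃ j, (p j x₀ ≠ 0 ∧ (p j x₀).eval ξ = 0) ∧
      ∀ i, (p i x₀ ≠ 0 ∧ (p i x₀).eval ξ = 0) → (p j x₀).natDegree ≤ (p i x₀).natDegree := by
    obtain ⟨j, hj, hmin⟩ := Set.exists_min_image
      {i | p i x₀ ≠ 0 ∧ (p i x₀).eval ξ = 0} (fun i => (p i x₀).natDegree) (Set.toFinite _) hξ
    exact ⟨j, hj, hmin⟩
  obtain ⟨k, hk⟩ := hp.der j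
  have hdeg : 0 < (p j x₀).natDegree := by
    by_contra h
    rw [Polynomial.eq_C_of_natDegree_eq_zero (by omega : (p j x₀).natDegree = 0)] at hj0 hjξ
    simp only [Polynomial.eval_C] at hjξ
    exact hj0 (by rw [hjξ, Polynomial.C_0])
  have hder : (p j x₀).derivative.eval ξ ≠ 0 := by
    intro h
    have h1 : p k x₀ ≠ 0 := by
      rw [hk, Ne, Polynomial.derivative_eq_zero]; omega
    have h2 := hmin k ⟨h1, by rw [hk]; exact h⟩
    rw [hk] at h2
    exact h2.not_gt (Polynomial.natDegree_derivative_lt hdeg.ne')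
  have hd : HasDerivAt (fun w => (p j x₀).eval w) ((p j x₀).derivative.eval ξ) ξ :=
    (p j x₀).hasDerivAt ξ
  -- a sign change close to `ξ`
  obtain ⟨a, b, ha, hb, hab⟩ : ∃ a b, |a - ξ| < ε ∧ |b - ξ| < ε ∧
      (p j x₀).eval a < 0 ∧ 0 < (p j x₀).eval b := by
    have key : ∀ r : Polynomial ℝ, r.eval ξ = 0 → 0 < r.derivative.eval ξ → ∃ a b,
        |a - ξ| < ε ∧ |b - ξ| < ε ∧ r.eval a < 0 ∧ 0 < r.eval b := by
      intro r hr hr'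
      have hcont : ∀ᶠ w in nhds ξ, 0 < r.derivative.eval w :=
        r.derivative.continuous.continuousAt.eventually_const_lt hr'
      obtain ⟨δ, hδ, hball⟩ := Metric.eventually_nhds_iff.1 hcont
      set η := min δ ε / 2 with hη
      have hη0 : 0 < η := by positivity
      have hηδ : η < δ := by
        have := min_le_left δ ε
        linarith [lt_min hδ hε]
      have hηε : η < ε := by
        have := min_le_right δ ε
        linarith [lt_min hδ hε]
      have hm : StrictMonoOn (fun x => r.eval x) (Set.Icc (ξ - η) (ξ + η)) := by
        apply strictMonoOn_of_deriv_pos (convex_Icc _ _) r.continuous.continuousOn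
        intro x hx
        rw [interior_Icc] at hx
        rw [Polynomial.deriv]
        apply hball
        rw [Real.dist_eq, abs_lt]
        constructor <;> linarith [hx.1, hx.2]
      have h1 := hm (a := ξ - η) (b := ξ) ⟨le_rfl, by linarith⟩ ⟨by linarith, by linarith⟩
        (by linarith)
      have h2 := hm (a := ξ) (b := ξ + η) ⟨by linarith, by linarith⟩ ⟨by linarith, le_rfl⟩
        (by linarith)
      simp only [hr] at h1 h2
      refine ⟨ξ - η, ξ + η, ?_, ?_, h1, h2⟩
      · rw [abs_lt]; constructor <;> linarith
      · rw [abs_lt]; constructor <;> linarith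
    rcases lt_or_gt_of_ne hder with h | h
    · obtain ⟨a, b, h1, h2, h3, h4⟩ := key (-(p j x₀)) (by simpa using hjξ) (by simpa using h)
      exact ⟨b, a, h2, h1, by simpa using h4, by simpa using h3⟩
    · exact key _ hjξ h
  have hcont : ∀ w, Continuous fun x => (p j x).eval w := fun w =>
    (hp.continuous_eval j).comp (continuous_id.prodMk continuous_const)
  filter_upwards [(hcont a).continuousAt.eventually_lt_const hab.1,
    (hcont b).continuousAt.eventually_const_lt hab.2] with x hxa hxb
  obtain ⟨ζ, hζ, hζ0⟩ := intermediate_value_uIcc (a := a) (b := b)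
    (f := fun w => (p j x).eval w) (p j x).continuous.continuousOn
    (Set.mem_uIcc.2 (Or.inl ⟨hxa.le, hxb.le⟩))
  refine ⟨ζ, ⟨j, (hp.eq_zero_iff j x₀ x).not.1 hj0, hζ0⟩, ?_⟩
  rw [abs_lt] at ha hb ⊢
  rcases Set.mem_uIcc.1 hζ with h | h
  · constructor <;> linarith
  · constructor <;> linarith

/-- Matched roots converge to matched roots. -/
theorem exists_tendsto_matched [Finite ι] (hp : GoodFamily p) (hq : GoodFamily q)
    {θ : X → ℝ ≃o ℝ} (hθ : ∀ i x, SignMatch (θ x) (p i x) (q i x)) {x₀ : X}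
    {𝒰 : Ultrafilter X} (h𝒰 : (𝒰 : Filter X) ≤ nhds x₀) {ζ : X → ℝ}
    (hζ : ∀ᶠ x in (𝒰 : Filter X), ζ x ∈ rootSet p x) :
    ∃ ξ ∈ rootSet p x₀, Filter.Tendsto ζ 𝒰 (nhds ξ) ∧
      Filter.Tendsto (fun x => θ x (ζ x)) 𝒰 (nhds (θ x₀ ξ)) := by
  obtain ⟨i, hi⟩ : ∃ i, ∀ᶠ x in (𝒰 : Filter X), p i x ≠ 0 ∧ (p i x).eval (ζ x) = 0 := by
    have h := hζ
    simp only [rootSet, Set.mem_ofPred_eq] at h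
    exact Ultrafilter.eventually_exists_iff.1 h
  obtain ⟨τ, hτ⟩ : ∃ τ : ι → SignType, ∀ᶠ x in (𝒰 : Filter X),
      (fun j => SignType.sign ((p j x).eval (ζ x))) = τ :=
    Ultrafilter.eventually_exists_iff.1 (Filter.Eventually.of_forall fun x => ⟨_, rfl⟩)
  have hτ' : ∀ j, ∀ᶠ x in (𝒰 : Filter X), SignType.sign ((p j x).eval (ζ x)) = τ j :=
    fun j => hτ.mono fun x hx => congrFun hx j
  have hp0 : p i x₀ ≠ 0 := by
    obtain ⟨x, hx⟩ := hi.exists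
    exact (hp.eq_zero_iff i x x₀).not.1 hx.1
  have hqz : q i x₀ ≠ 0 := by
    intro h
    apply hp0
    apply Polynomial.funext
    intro w
    rw [Polynomial.eval_zero, (hθ i x₀).eq_zero_iff, h, Polynomial.eval_zero]
  obtain ⟨ξ, hξ⟩ := hp.exists_tendsto_of_root i hp0 h𝒰 (hi.mono fun x hx => hx.2)
  obtain ⟨ξ', hξ'⟩ := hq.exists_tendsto_of_root i hqz (ζ := fun x => θ x (ζ x)) h𝒰
    (hi.mono fun x hx => ((hθ i x).eq_zero_iff _).1 hx.2)
  have hτi : τ i = 0 := by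
    obtain ⟨x, hx1, hx2⟩ := ((hτ' i).and hi).exists
    rw [← hx1, hx2.2, sign_zero]
  have hw : ∀ j, WeakSign (τ j) ((p j x₀).eval ξ) := fun j =>
    WeakSign.of_tendsto (hp.tendsto_eval j h𝒰 hξ) (hτ' j)
  have hw' : ∀ j, WeakSign (τ j) ((q j x₀).eval ξ') := fun j =>
    WeakSign.of_tendsto (hq.tendsto_eval j h𝒰 hξ')
      ((hτ' j).mono fun x hx => by rw [← hx, hθ j x])
  have hroot : (p i x₀).eval ξ = 0 := by
    have := hw i
    rw [hτi] at this
    exact le_antisymm (this.2 le_rfl) (this.1 le_rfl)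
  have heq : ξ' = θ x₀ ξ := by
    refine eq_of_weakSign (p := fun j => q j x₀) ?_ hw' (fun j => (hw j).of_sign_eq (hθ j x₀ ξ))
      (i := i) hqz hτi
    intro j
    obtain ⟨k, hk⟩ := hq.der j
    exact ⟨k, hk x₀⟩
  exact ⟨ξ, ⟨i, hp0, hroot⟩, hξ, heq ▸ hξ'⟩

open Real in
theorem exists_tendsto_node [Finite ι] (hp : GoodFamily p) (hq : GoodFamily q)
    {θ : X → ℝ ≃o ℝ} (hθ : ∀ i x, SignMatch (θ x) (p i x) (q i x)) {x₀ : X}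
    {𝒰 : Ultrafilter X} (h𝒰 : (𝒰 : Filter X) ≤ nhds x₀) {a : X → ℝ}
    (ha : ∀ᶠ x in (𝒰 : Filter X), a x ∈ interpNodes (rootSet p x)) :
    ∃ b ∈ interpNodes (rootSet p x₀), Filter.Tendsto a 𝒰 (nhds b) ∧
      Filter.Tendsto (fun x => compactified (θ x) (a x)) 𝒰 (nhds (compactified (θ x₀) b)) := by
  have h : (∀ᶠ x in (𝒰 : Filter X), a x = -(π / 2)) ∨ (∀ᶠ x in (𝒰 : Filter X), a x = π / 2) ∨
      ∀ᶠ x in (𝒰 : Filter X), a x ∈ arctan '' rootSet p x := by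
    rw [← Ultrafilter.eventually_or, ← Ultrafilter.eventually_or]
    exact ha
  rcases h with h | h | h
  · refine ⟨-(π / 2), Or.inl rfl, tendsto_const_nhds.congr' (h.mono fun x hx => hx.symm),
      tendsto_const_nhds.congr' (h.mono fun x hx => ?_)⟩
    simp only [hx, compactified_left]
  · refine ⟨π / 2, Or.inr (Or.inl rfl), tendsto_const_nhds.congr' (h.mono fun x hx => hx.symm),
      tendsto_const_nhds.congr' (h.mono fun x hx => ?_)⟩
    simp only [hx, compactified_right]
  · have hζ : ∀ᶠ x in (𝒰 : Filter X), tan (a x) ∈ rootSet p x ∧ arctan (tan (a x)) = a x := by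
      filter_upwards [h] with x hx
      obtain ⟨ζ, h1, h2⟩ := hx
      rw [← h2, tan_arctan]
      exact ⟨h1, rfl⟩
    obtain ⟨ξ, hξ, h1, h2⟩ := hp.exists_tendsto_matched hq hθ h𝒰 (hζ.mono fun x hx => hx.1)
    refine ⟨arctan ξ, Or.inr (Or.inr ⟨ξ, hξ, rfl⟩), ?_, ?_⟩
    · exact ((continuous_arctan.tendsto ξ).comp h1).congr' (hζ.mono fun x hx => hx.2)
    · rw [compactified_arctan]
      refine ((continuous_arctan.tendsto _).comp h2).congr' (hζ.mono fun x hx => ?_)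
      change _ = compactified (θ x) (a x)
      conv_rhs => rw [← hx.2]
      rw [compactified_arctan, Function.comp_apply]

open Real in
theorem exists_node_near [Finite ι] (hp : GoodFamily p) {x₀ : X} {b : ℝ}
    (hb : b ∈ interpNodes (rootSet p x₀)) {ε : ℝ} (hε : 0 < ε) :
    ∀ᶠ x in nhds x₀, ∃ a ∈ interpNodes (rootSet p x), |a - b| < ε := by
  rcases hb with rfl | rfl | ⟨ξ, hξ, rfl⟩
  · exact Filter.Eventually.of_forall fun x => ⟨_, Or.inl rfl, by simpa using hε⟩
  · exact Filter.Eventually.of_forall fun x => ⟨_, Or.inr (Or.inl rfl), by simpa using hε⟩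
  · obtain ⟨δ, hδ, h⟩ := Metric.continuousAt_iff.1 continuous_arctan.continuousAt ε hε
    filter_upwards [hp.exists_root_near hξ hδ] with x hx
    obtain ⟨ζ, hζ, hd⟩ := hx
    exact ⟨arctan ζ, Or.inr (Or.inr ⟨ζ, hζ, rfl⟩), h hd⟩

theorem tendsto_lowerNbr [Finite ι] (hp : GoodFamily p) {x₀ : X} {t b : ℝ}
    (ht : t ∉ interpNodes (rootSet p x₀)) (htl : -(Real.pi / 2) < t)
    {l : Filter X} [l.NeBot] (hl : l ≤ nhds x₀)
    (h : Filter.Tendsto (fun x => lowerNbr (interpNodes (rootSet p x)) t) l (nhds b))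
    (hb : b ∈ interpNodes (rootSet p x₀)) : b = lowerNbr (interpNodes (rootSet p x₀)) t := by
  have hspec := fun x => lowerNbr_spec (A := interpNodes (rootSet p x))
    (interpNodes_finite (rootSet_finite p x)) (Or.inl rfl) htl.le
  have hbt : b ≤ t := le_of_tendsto h (Filter.Eventually.of_forall fun x => (hspec x).2)
  refine le_antisymm (le_lowerNbr hb hbt) ?_
  by_contra! hlt
  obtain ⟨h1, h2⟩ := hspec x₀
  set c := lowerNbr (interpNodes (rootSet p x₀)) t
  have hct : c < t := lt_of_le_of_ne h2 fun h => ht (h ▸ h1)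
  have hε : 0 < min ((c - b) / 2) (t - c) := lt_min (by linarith) (by linarith)
  have := ge_of_tendsto (b := c - (c - b) / 2) h (((hp.exists_node_near h1 hε).filter_mono hl).mono
    fun x ⟨a, ha, hac⟩ => ?_)
  · linarith
  · rw [abs_lt] at hac
    have k1 := min_le_left ((c - b) / 2) (t - c)
    have k2 := min_le_right ((c - b) / 2) (t - c)
    have := le_lowerNbr ha (t := t) (by linarith)
    linarith

theorem tendsto_upperNbr [Finite ι] (hp : GoodFamily p) {x₀ : X} {t b : ℝ}
    (ht : t ∉ interpNodes (rootSet p x₀)) (htr : t < Real.pi / 2)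
    {l : Filter X} [l.NeBot] (hl : l ≤ nhds x₀)
    (h : Filter.Tendsto (fun x => upperNbr (interpNodes (rootSet p x)) t) l (nhds b))
    (hb : b ∈ interpNodes (rootSet p x₀)) : b = upperNbr (interpNodes (rootSet p x₀)) t := by
  have hspec := fun x => upperNbr_spec (A := interpNodes (rootSet p x))
    (interpNodes_finite (rootSet_finite p x)) (Or.inr (Or.inl rfl)) htr
  have hbt : t ≤ b := ge_of_tendsto h (Filter.Eventually.of_forall fun x => (hspec x).2.le)
  refine le_antisymm ?_ (upperNbr_le hb (lt_of_le_of_ne hbt fun h => ht (h ▸ hb)))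
  by_contra! hlt
  obtain ⟨h1, h2⟩ := hspec x₀
  set c := upperNbr (interpNodes (rootSet p x₀)) t
  have hε : 0 < min ((b - c) / 2) (c - t) := lt_min (by linarith) (by linarith)
  have := le_of_tendsto (b := c + (b - c) / 2) h (((hp.exists_node_near h1 hε).filter_mono hl).mono
    fun x ⟨a, ha, hac⟩ => ?_)
  · linarith
  · rw [abs_lt] at hac
    have k1 := min_le_left ((b - c) / 2) (c - t)
    have k2 := min_le_right ((b - c) / 2) (c - t)
    have := upperNbr_le ha (t := t) (by linarith)
    linarith

open Real in
theorem tendsto_interp [Finite ι] (hp : GoodFamily p) (hq : GoodFamily q)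
    {θ : X → ℝ ≃o ℝ} (hθ : ∀ i x, SignMatch (θ x) (p i x) (q i x)) {x₀ : X} {w : ℝ}
    (hw : w ∉ rootSet p x₀) :
    Filter.Tendsto
      (fun x => tan (plInterp (interpNodes (rootSet p x)) (compactified (θ x)) (arctan w)))
      (nhds x₀)
      (nhds (tan (plInterp (interpNodes (rootSet p x₀)) (compactified (θ x₀)) (arctan w)))) := by
  have htm := arctan_mem_Ioo w
  have ht : arctan w ∉ interpNodes (rootSet p x₀) := by
    rintro (h | h | ⟨ξ, hξ, h⟩)
    · exact htm.1.ne' h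
    · exact htm.2.ne h
    · exact hw (arctan_injective h ▸ hξ)
  set t := arctan w
  have hspec := fun x => lowerNbr_spec (A := interpNodes (rootSet p x))
    (interpNodes_finite (rootSet_finite p x)) (Or.inl rfl) htm.1.le
  have hspec' := fun x => upperNbr_spec (A := interpNodes (rootSet p x))
    (interpNodes_finite (rootSet_finite p x)) (Or.inr (Or.inl rfl)) htm.2
  have htan : ContinuousAt tan
      (plInterp (interpNodes (rootSet p x₀)) (compactified (θ x₀)) t) :=
    continuousAt_tan.2 (cos_pos_of_mem_Ioo
      (plInterp_compactified_mem (rootSet_finite p x₀) (θ x₀) htm)).ne'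
  refine htan.tendsto.comp ?_
  rw [Filter.tendsto_iff_ultrafilter]
  intro 𝒰 h𝒰
  obtain ⟨b, hb, hb1, hb2⟩ := hp.exists_tendsto_node hq hθ h𝒰
    (Filter.Eventually.of_forall fun x => (hspec x).1)
  obtain rfl := hp.tendsto_lowerNbr ht htm.1 h𝒰 hb1 hb
  obtain ⟨c, hc, hc1, hc2⟩ := hp.exists_tendsto_node hq hθ h𝒰
    (Filter.Eventually.of_forall fun x => (hspec' x).1)
  obtain rfl := hp.tendsto_upperNbr ht htm.2 h𝒰 hc1 hc
  have hne : upperNbr (interpNodes (rootSet p x₀)) t - lowerNbr (interpNodes (rootSet p x₀)) t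
      ≠ 0 := by
    have := (hspec x₀).2
    have := (hspec' x₀).2
    linarith
  exact hb2.add (((tendsto_const_nhds.sub hb1).div (hc1.sub hb1) hne).mul (hc2.sub hb2))

end GoodFamily

/-- A family of order isomorphisms of the line is jointly continuous as soon as it is
continuous in the parameter away from finitely many points. -/
theorem continuous_uncurry_orderIso {X : Type*} [TopologicalSpace X] {φ : X → ℝ ≃o ℝ}
    (h : ∀ x₀, ∃ Z : Set ℝ, Z.Finite ∧ ∀ w ∉ Z,
      Filter.Tendsto (fun x => φ x w) (nhds x₀) (nhds (φ x₀ w))) :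
    Continuous fun z : X × ℝ => φ z.1 z.2 := by
  refine continuous_iff_continuousAt.2 fun ⟨x₀, w₀⟩ => tendsto_order.2 ⟨fun a ha => ?_, fun a ha => ?_⟩
  · obtain ⟨Z, hZ, hc⟩ := h x₀
    obtain ⟨w, hw, hwZ⟩ := ((Set.Ioo_infinite ((φ x₀).symm_apply_lt.2 ha)).sdiff hZ).nonempty
    have h1 := (hc w hwZ).eventually_const_lt ((φ x₀).symm_apply_lt.1 hw.1)
    rw [nhds_prod_eq]
    filter_upwards [h1.prod_mk (lt_mem_nhds hw.2)] with z hz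
    exact hz.1.trans ((φ z.1).strictMono hz.2)
  · obtain ⟨Z, hZ, hc⟩ := h x₀
    obtain ⟨w, hw, hwZ⟩ := ((Set.Ioo_infinite ((φ x₀).lt_symm_apply.2 ha)).sdiff hZ).nonempty
    have h1 := (hc w hwZ).eventually_lt_const ((φ x₀).lt_symm_apply.1 hw.2)
    rw [nhds_prod_eq]
    filter_upwards [h1.prod_mk (gt_mem_nhds hw.1)] with z hz
    exact ((φ z.1).strictMono hz.2).trans hz.1

theorem continuous_uncurry_symm {X : Type*} [TopologicalSpace X] {φ : X → ℝ ≃o ℝ}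
    (h : Continuous fun z : X × ℝ => φ z.1 z.2) :
    Continuous fun z : X × ℝ => (φ z.1).symm z.2 := by
  have h' : ∀ w, Continuous fun x => φ x w := fun w =>
    h.comp (continuous_id.prodMk continuous_const)
  refine continuous_iff_continuousAt.2 fun ⟨x₀, w₀⟩ => tendsto_order.2 ⟨fun a ha => ?_, fun a ha => ?_⟩
  · obtain ⟨c, hc1, hc2⟩ := exists_between ((φ x₀).lt_symm_apply.1 ha)
    rw [nhds_prod_eq]
    filter_upwards [((h' a).continuousAt.eventually_lt_const hc1).prod_mk (lt_mem_nhds hc2)]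
      with z hz
    exact (φ z.1).lt_symm_apply.2 (hz.1.trans hz.2)
  · obtain ⟨c, hc1, hc2⟩ := exists_between ((φ x₀).symm_apply_lt.1 ha)
    rw [nhds_prod_eq]
    filter_upwards [((h' a).continuousAt.eventually_const_lt hc2).prod_mk (gt_mem_nhds hc1)]
      with z hz
    exact (φ z.1).symm_apply_lt.2 (hz.2.trans hz.1)

/-- Fibrewise sign matchings between good families can be made continuous. -/
theorem GoodFamily.exists_continuous_signMatch {X ι : Type*} [TopologicalSpace X] [Finite ι]
    {p q : ι → X → Polynomial ℝ} (hp : GoodFamily p) (hq : GoodFamily q)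
    (h : ∀ x, ∃ θ : ℝ ≃o ℝ, ∀ i, SignMatch θ (p i x) (q i x)) :
    ∃ φ : X → ℝ ≃o ℝ, (Continuous fun z : X × ℝ => φ z.1 z.2) ∧
      ∀ i x, SignMatch (φ x) (p i x) (q i x) := by
  choose θ hθ' using h
  have hθ : ∀ i x, SignMatch (θ x) (p i x) (q i x) := fun i x => hθ' x i
  choose φ hφ hφZ using fun x => exists_interpIso (rootSet_finite p x) (θ x)
  refine ⟨φ, continuous_uncurry_orderIso fun x₀ =>
    ⟨rootSet p x₀, rootSet_finite p x₀, fun w hw => ?_⟩, fun i x => ?_⟩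
  · simp only [hφ]
    exact hp.tendsto_interp hq hθ hw
  · by_cases h0 : p i x = 0
    · have hz : q i x = 0 := by
        apply Polynomial.funext
        intro w
        obtain ⟨v, rfl⟩ := (θ x).surjective w
        rw [Polynomial.eval_zero, ← (hθ i x).eq_zero_iff, h0, Polynomial.eval_zero]
      intro w
      simp [h0, hz]
    · exact (hθ i x).congr fun w hw => hφZ x w ⟨i, h0, hw⟩

/-! ### Closure under derivatives -/

section DerivClosure

variable {R : Type*} [CommRing R]

/-- A finite set of polynomials closed under derivatives and containing `F`. -/
noncomputable def derivClosure (F : Finset (Polynomial R)) : Finset (Polynomial R) := by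
  classical exact F.biUnion fun p =>
    (Finset.range (p.natDegree + 2)).image fun n => Polynomial.derivative^[n] p

theorem mem_derivClosure {F : Finset (Polynomial R)} {q : Polynomial R} :
    q ∈ derivClosure F ↔ ∃ p ∈ F, ∃ n < p.natDegree + 2, Polynomial.derivative^[n] p = q := by
  simp [derivClosure]

theorem subset_derivClosure {F : Finset (Polynomial R)} {p : Polynomial R} (hp : p ∈ F) :
    p ∈ derivClosure F :=
  mem_derivClosure.2 ⟨p, hp, 0, by omega, rfl⟩

theorem derivative_mem_derivClosure {F : Finset (Polynomial R)} {q : Polynomial R}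
    (hq : q ∈ derivClosure F) : q.derivative ∈ derivClosure F := by
  obtain ⟨p, hp, n, hn, rfl⟩ := mem_derivClosure.1 hq
  by_cases h : n < p.natDegree + 1
  · exact mem_derivClosure.2 ⟨p, hp, n + 1, by omega, Function.iterate_succ_apply' _ _ _⟩
  · refine mem_derivClosure.2 ⟨p, hp, n, hn, ?_⟩
    rw [Polynomial.iterate_derivative_eq_zero (by omega), Polynomial.derivative_zero]

theorem derivClosure_induction {F : Finset (Polynomial R)} {C : Polynomial R → Prop}
    (hF : ∀ p ∈ F, C p) (hd : ∀ p, C p → C p.derivative) {q : Polynomial R}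
    (hq : q ∈ derivClosure F) : C q := by
  obtain ⟨p, hp, n, -, rfl⟩ := mem_derivClosure.1 hq
  clear hq
  induction n with
  | zero => exact hF p hp
  | succ n ih => rw [Function.iterate_succ_apply']; exact hd _ ih

theorem degree_derivative_eq_of_degree_eq {p q : Polynomial ℝ} (h : p.degree = q.degree) :
    p.derivative.degree = q.derivative.degree := by
  have hn := Polynomial.natDegree_eq_of_degree_eq h
  rcases Nat.eq_zero_or_pos p.natDegree with h0 | h0
  · rw [Polynomial.derivative_eq_zero.2 h0, Polynomial.derivative_eq_zero.2 (hn ▸ h0)]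
  · rw [Polynomial.degree_derivative h0.ne', Polynomial.degree_derivative (hn ▸ h0.ne'), hn]

theorem goodFamily_derivClosure {X : Type*} [TopologicalSpace X] {F : Finset (Polynomial R)}
    {e : X → R →+* ℝ} (he : ∀ a, Continuous fun x => e x a)
    (hF : ∀ p ∈ F, ∀ x y, (p.map (e x)).degree = (p.map (e y)).degree) :
    GoodFamily fun (p : derivClosure F) x => p.1.map (e x) where
  cont p n := by simpa only [Polynomial.coeff_map] using he _
  deg p x y := by
    refine derivClosure_induction (C := fun p => (p.map (e x)).degree = (p.map (e y)).degree)
      (fun p hp => hF p hp x y) (fun p hp => ?_) p.2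
    rw [← Polynomial.derivative_map, ← Polynomial.derivative_map]
    exact degree_derivative_eq_of_degree_eq hp
  der p := ⟨⟨p.1.derivative, derivative_mem_derivClosure p.2⟩, fun x =>
    (Polynomial.derivative_map p.1 (e x)).symm⟩

end DerivClosure

/-! ### Shears -/

section Shear

variable {R : Type*} [CommRing R] {k : ℕ}

/-- Substitution of `W` for the first variable and of `Xᵢ + W vᵢ` for the others. -/
noncomputable def shearHom (v : Fin k → R) :
    MvPolynomial (Fin (k + 1)) R →+* Polynomial (MvPolynomial (Fin k) R) :=
  eval₂Hom (Polynomial.C.comp C)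
    (Fin.cons Polynomial.X fun i => Polynomial.C (X i) + Polynomial.X * Polynomial.C (C (v i)))

theorem eval_map_shearHom {K : Type*} [CommRing K] (φ : R →+* K) (v : Fin k → R) (x : Fin k → K)
    (w : K) (P : MvPolynomial (Fin (k + 1)) R) :
    ((shearHom v P).map (eval₂Hom φ x)).eval w =
      eval₂Hom φ (Fin.cons w fun i => x i + w * φ (v i)) P := by
  have : (((Polynomial.evalRingHom w).comp (Polynomial.mapRingHom (eval₂Hom φ x))).comp
      (shearHom v)) = eval₂Hom φ (Fin.cons w fun i => x i + w * φ (v i)) := by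
    refine MvPolynomial.ringHom_ext (fun r => ?_) fun i => ?_
    · simp [shearHom]
    · refine Fin.cases ?_ (fun i => ?_) i <;> simp [shearHom, mul_comm w]
  exact RingHom.congr_fun this P

theorem map_shearHom {K : Type*} [CommRing K] (φ : R →+* K) (v : Fin k → R) (x : Fin k → K)
    (P : MvPolynomial (Fin (k + 1)) R) :
    (shearHom v P).map (eval₂Hom φ x) = (shearHom (fun i => φ (v i)) (P.map φ)).map (eval x) := by
  have : ((Polynomial.mapRingHom (eval₂Hom φ x)).comp (shearHom v)) =
      ((Polynomial.mapRingHom (eval x)).comp (shearHom fun i => φ (v i))).comp (map φ) := by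
    refine MvPolynomial.ringHom_ext (fun r => ?_) fun i => ?_
    · simp [shearHom]
    · refine Fin.cases ?_ (fun i => ?_) i <;> simp [shearHom]
  exact RingHom.congr_fun this P

theorem natDegree_prod_le_and_coeff {A ι : Type*} [CommRing A] (t : Finset ι)
    (f : ι → Polynomial A) (s : ι → ℕ) (hf : ∀ i, (f i).natDegree ≤ 1) :
    (∏ i ∈ t, f i ^ s i).natDegree ≤ ∑ i ∈ t, s i ∧
      (∏ i ∈ t, f i ^ s i).coeff (∑ i ∈ t, s i) = ∏ i ∈ t, (f i).coeff 1 ^ s i := by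
  classical
  have hp : ∀ i, (f i ^ s i).natDegree ≤ s i := fun i => by
    simpa using Polynomial.natDegree_pow_le_of_le (s i) (hf i)
  induction t using Finset.induction_on with
  | empty => simp
  | insert a t ha ih =>
    simp only [Finset.prod_insert ha, Finset.sum_insert ha]
    refine ⟨Polynomial.natDegree_mul_le_of_le (hp a) ih.1, ?_⟩
    rw [Polynomial.coeff_mul_add_eq_of_natDegree_le (hp a) ih.1, ih.2]
    congr 1
    simpa using Polynomial.coeff_pow_of_natDegree_le (m := s a) (hf a)

theorem shearHom_monomial (v : Fin k → R) (s : Fin (k + 1) →₀ ℕ) (a : R) :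
    (shearHom v (monomial s a)).natDegree ≤ s.degree ∧
      (shearHom v (monomial s a)).coeff s.degree = C (eval (Fin.cons 1 v) (monomial s a)) := by
  set f : Fin (k + 1) → Polynomial (MvPolynomial (Fin k) R) :=
    Fin.cons Polynomial.X fun i => Polynomial.C (X i) + Polynomial.X * Polynomial.C (C (v i))
    with hf
  have h1 : ∀ i, (f i).natDegree ≤ 1 := by
    refine Fin.cases ?_ fun i => ?_
    · exact Polynomial.natDegree_X_le
    · simp only [hf, Fin.cons_succ]
      compute_degree
  have h2 : ∀ i, (f i).coeff 1 = C ((Fin.cons 1 v : Fin (k + 1) → R) i) := by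
    refine Fin.cases ?_ fun i => ?_
    · simp [hf]
    · simp [hf, Polynomial.coeff_C]
  have hs : shearHom v (monomial s a) = Polynomial.C (C a) * ∏ i, f i ^ s i := by
    rw [shearHom, coe_eval₂Hom, eval₂_monomial, Finsupp.prod_fintype _ _ (fun i => pow_zero _)]
    rfl
  obtain ⟨h3, h4⟩ := natDegree_prod_le_and_coeff Finset.univ f s h1
  have hdeg : s.degree = ∑ i, s i := Finsupp.degree_eq_sum s
  rw [hs, hdeg]
  refine ⟨(Polynomial.natDegree_C_mul_le _ _).trans h3, ?_⟩
  rw [Polynomial.coeff_C_mul, h4, eval_monomial, Finsupp.prod_fintype _ _ (fun i => pow_zero _),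
    map_mul, map_prod]
  simp only [h2, map_pow]

theorem shearHom_natDegree_le_and_coeff (v : Fin k → R) (P : MvPolynomial (Fin (k + 1)) R) {d : ℕ}
    (hd : P.totalDegree ≤ d) :
    (shearHom v P).natDegree ≤ d ∧
      (shearHom v P).coeff d = C (eval (Fin.cons 1 v) (homogeneousComponent d P)) := by
  have hP : shearHom v P = ∑ s ∈ P.support, shearHom v (monomial s (P.coeff s)) := by
    conv_lhs => rw [P.as_sum]
    exact map_sum _ _ _
  have hle : ∀ s ∈ P.support, s.degree ≤ d := fun s hs => by
    have := le_totalDegree hs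
    exact (show s.degree ≤ P.totalDegree from this).trans hd
  rw [hP]
  refine ⟨Polynomial.natDegree_sum_le_of_forall_le _ _ fun s hs =>
    (shearHom_monomial v s _).1.trans (hle s hs), ?_⟩
  rw [Polynomial.finsetSum_coeff, homogeneousComponent_apply, map_sum, map_sum,
    Finset.sum_filter]
  refine Finset.sum_congr rfl fun s hs => ?_
  split_ifs with h
  · rw [← h, (shearHom_monomial v s _).2]
  · exact Polynomial.coeff_eq_zero_of_natDegree_lt
      ((shearHom_monomial v s _).1.trans_lt (lt_of_le_of_ne (hle s hs) h))

theorem eval_smul_of_isHomogeneous {σ : Type*} [Fintype σ] {Q : MvPolynomial σ R} {d : ℕ}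
    (hQ : Q.IsHomogeneous d) (a : R) (x : σ → R) :
    eval (fun i => a * x i) Q = a ^ d * eval x Q := by
  rw [eval_eq', eval_eq', Finset.mul_sum]
  refine Finset.sum_congr rfl fun s hs => ?_
  have := (Finsupp.degree_eq_sum s).symm.trans
    ((Finsupp.degree_eq_weight_one (R := ℕ) ▸ hQ (mem_support_iff.1 hs) : s.degree = d))
  simp only [mul_pow, Finset.prod_mul_distrib, Finset.prod_pow_eq_pow_sum]
  rw [this]
  ring

theorem homogeneousComponent_totalDegree_ne_zero {σ : Type*} {P : MvPolynomial σ R} (hP : P ≠ 0) :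
    homogeneousComponent P.totalDegree P ≠ 0 := by
  obtain ⟨s, hs, h⟩ := Finset.exists_mem_eq_sup P.support (support_nonempty.2 hP)
    fun s => s.sum fun _ e => e
  intro h0
  have := coeff_homogeneousComponent P.totalDegree P s
  rw [h0, coeff_zero, if_pos] at this
  · exact mem_support_iff.1 hs this.symm
  · exact h.symm

/-- Over an infinite field a generic shear makes finitely many polynomials monic up to a
constant. -/
theorem exists_shear {K : Type*} [Field K] [Infinite K] (F : Finset (MvPolynomial (Fin (k + 1)) K)) :
    ∃ v : Fin k → K, ∀ P ∈ F, P ≠ 0 → ∃ c : K, c ≠ 0 ∧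
      (shearHom v P).natDegree ≤ P.totalDegree ∧ (shearHom v P).coeff P.totalDegree = C c := by
  classical
  have h0 : X 0 * ∏ P ∈ F.filter (· ≠ 0), homogeneousComponent P.totalDegree P ≠ 0 := by
    refine mul_ne_zero (X_ne_zero _) (Finset.prod_ne_zero_iff.2 fun P hP => ?_)
    exact homogeneousComponent_totalDegree_ne_zero (Finset.mem_filter.1 hP).2
  obtain ⟨u, hu⟩ : ∃ u, eval u (X 0 * ∏ P ∈ F.filter (· ≠ 0),
      homogeneousComponent P.totalDegree P) ≠ 0 := by
    by_contra! h
    exact h0 (MvPolynomial.funext fun u => by rw [h u, map_zero])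
  rw [map_mul, eval_X, map_prod] at hu
  have hu0 : u 0 ≠ 0 := left_ne_zero_of_mul hu
  have hu1 := Finset.prod_ne_zero_iff.1 (right_ne_zero_of_mul hu)
  refine ⟨fun i => (u 0)⁻¹ * u i.succ, fun P hP hP0 => ⟨_, ?_,
    shearHom_natDegree_le_and_coeff _ P le_rfl⟩⟩
  have hcons : (Fin.cons 1 fun i : Fin k => (u 0)⁻¹ * u i.succ : Fin (k + 1) → K) =
      fun i => (u 0)⁻¹ * u i := by
    ext i
    refine Fin.cases ?_ (fun i => ?_) i <;> simp [hu0]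
  rw [hcons, eval_smul_of_isHomogeneous (homogeneousComponent_isHomogeneous _ _)]
  exact mul_ne_zero (pow_ne_zero _ (inv_ne_zero hu0)) (hu1 P (Finset.mem_filter.2 ⟨hP, hP0⟩))

end Shear

/-! ### Triangular homeomorphisms and semialgebraic triviality -/

theorem GoodFamily.comp {X Y ι : Type*} [TopologicalSpace X] [TopologicalSpace Y]
    {p : ι → X → Polynomial ℝ} (hp : GoodFamily p) {h : Y → X} (hh : Continuous h) :
    GoodFamily fun i y => p i (h y) where
  cont i n := (hp.cont i n).comp hh
  deg i _ _ := hp.deg i _ _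
  der i := (hp.der i).imp fun _ hj _ => hj _

/-- The homeomorphism that, after undoing the shear `v` and redoing the shear `v'`, is
`(x, w) ↦ (h x, φ x w)`. -/
def triangularHomeo {k : ℕ} (h : (Fin k → ℝ) ≃ₜ (Fin k → ℝ)) (φ : (Fin k → ℝ) → ℝ ≃o ℝ)
    (hφ : Continuous fun z : (Fin k → ℝ) × ℝ => φ z.1 z.2) (v v' : Fin k → ℝ) :
    (Fin (k + 1) → ℝ) ≃ₜ (Fin (k + 1) → ℝ) where
  toFun z := Fin.cons (φ (fun i => z i.succ - z 0 * v i) (z 0)) fun i =>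
    h (fun i => z i.succ - z 0 * v i) i + φ (fun i => z i.succ - z 0 * v i) (z 0) * v' i
  invFun z := Fin.cons ((φ (h.symm fun i => z i.succ - z 0 * v' i)).symm (z 0)) fun i =>
    h.symm (fun i => z i.succ - z 0 * v' i) i +
      (φ (h.symm fun i => z i.succ - z 0 * v' i)).symm (z 0) * v i
  left_inv z := by
    ext i
    refine Fin.cases ?_ (fun i => ?_) i <;> simp
  right_inv z := by
    ext i
    refine Fin.cases ?_ (fun i => ?_) i <;> simp
  continuous_toFun := by
    have h1 : Continuous fun z : Fin (k + 1) → ℝ => fun i : Fin k => z i.succ - z 0 * v i := by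
      fun_prop
    have h2 : Continuous fun z : Fin (k + 1) → ℝ => φ (fun i => z i.succ - z 0 * v i) (z 0) :=
      hφ.comp (h1.prodMk (continuous_apply 0))
    exact h2.finCons (continuous_pi fun i =>
      ((continuous_apply i).comp (h.continuous.comp h1)).add (h2.mul continuous_const))
  continuous_invFun := by
    have h1 : Continuous fun z : Fin (k + 1) → ℝ => h.symm fun i : Fin k => z i.succ - z 0 * v' i :=
      h.symm.continuous.comp (by fun_prop)
    have h2 : Continuous fun z : Fin (k + 1) → ℝ =>
        (φ (h.symm fun i => z i.succ - z 0 * v' i)).symm (z 0) :=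
      (continuous_uncurry_symm hφ).comp (h1.prodMk (continuous_apply 0))
    exact h2.finCons (continuous_pi fun i =>
      ((continuous_apply i).comp h1).add (h2.mul continuous_const))

/-- Evaluation of polynomials over a ring of functions. -/
noncomputable def evalAt {S : Type*} {k : ℕ} (s : S) (x : Fin k → ℝ) :
    MvPolynomial (Fin k) (S → ℝ) →+* ℝ :=
  eval₂Hom (Pi.evalRingHom (fun _ => ℝ) s) x

theorem continuous_evalAt {S : Type*} {k : ℕ} (s : S) (P : MvPolynomial (Fin k) (S → ℝ)) :
    Continuous fun x => evalAt s x P := by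
  have : (fun x => evalAt s x P) = fun x => eval x (P.map (Pi.evalRingHom (fun _ => ℝ) s)) := by
    ext x
    rw [evalAt, coe_eval₂Hom, eval_map]
  rw [this]
  exact MvPolynomial.continuous_eval _

/-- **Finiteness of topological types of sign partitions** in a family of finite sets of
polynomials with arbitrary parameters. -/
theorem exists_finite_coloring {S : Type*} (k : ℕ) (F : Finset (MvPolynomial (Fin k) (S → ℝ))) :
    ∃ (α : Type) (_ : Finite α) (χ : S → α), ∀ s s', χ s = χ s' →
      ∃ h : (Fin k → ℝ) ≃ₜ (Fin k → ℝ), ∀ x,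
        SignAgree (F : Set (MvPolynomial (Fin k) (S → ℝ))) (evalAt s x) (evalAt s' (h x)) := by
  classical
  induction k with
  | zero =>
    refine ⟨Fin F.card → SignType, inferInstance,
      fun s i => SignType.sign (evalAt s default (F.equivFin.symm i).1), fun s s' hs =>
        ⟨Homeomorph.refl _, fun x P hP => ?_⟩⟩
    have := congrFun hs (F.equivFin ⟨P, hP⟩)
    rw [Homeomorph.refl_apply, Subsingleton.elim x default]
    simpa using this
  | succ k ih =>
    choose v hv using fun s : S =>
      exists_shear (F.image fun P => P.map (Pi.evalRingHom (fun _ => ℝ) s))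
    set V : Fin k → (S → ℝ) := fun i s => v s i with hV
    have hdeg : ∀ s : S, ∀ p ∈ F.image (shearHom V), ∀ x y : Fin k → ℝ,
        (p.map (evalAt s x)).degree = (p.map (evalAt s y)).degree := by
      intro s p hp
      obtain ⟨P, hP, rfl⟩ := Finset.mem_image.1 hp
      have hmap : ∀ x : Fin k → ℝ, (shearHom V P).map (evalAt s x) =
          (shearHom (v s) (P.map (Pi.evalRingHom (fun _ => ℝ) s))).map (eval x) :=
        fun x => map_shearHom _ _ _ _
      by_cases h0 : P.map (Pi.evalRingHom (fun _ => ℝ) s) = 0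
      · intro x y
        rw [hmap, hmap, h0, map_zero, Polynomial.map_zero, Polynomial.map_zero]
      · obtain ⟨c, hc, h1, h2⟩ := hv s _ (Finset.mem_image_of_mem _ hP) h0
        have : ∀ x : Fin k → ℝ, ((shearHom V P).map (evalAt s x)).degree =
            (P.map (Pi.evalRingHom (fun _ => ℝ) s)).totalDegree := by
          intro x
          rw [hmap]
          refine Polynomial.degree_eq_of_le_of_coeff_ne_zero
            ((Polynomial.degree_le_of_natDegree_le (Polynomial.natDegree_map_le.trans h1))) ?_
          rw [Polynomial.coeff_map, h2, eval_C]
          exact hc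
        intro x y
        rw [this, this]
    obtain ⟨G, hG⟩ := exists_eliminates (derivClosure (F.image (shearHom V)))
    obtain ⟨α, hα, χ, hχ⟩ := ih G
    refine ⟨α, hα, χ, fun s s' hs => ?_⟩
    obtain ⟨h, hh⟩ := hχ s s' hs
    have hp := goodFamily_derivClosure (e := fun x => evalAt s x) (continuous_evalAt s) (hdeg s)
    have hq := (goodFamily_derivClosure (e := fun x => evalAt s' x) (continuous_evalAt s')
      (hdeg s')).comp h.continuous
    obtain ⟨φ, hφ, hφs⟩ := hp.exists_continuous_signMatch hq fun x => by
      obtain ⟨θ, hθ⟩ := hG _ _ (hh x)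
      exact ⟨θ, fun p => hθ p.1 p.2⟩
    refine ⟨triangularHomeo h φ hφ (v s) (v s'), fun z P hP => ?_⟩
    have key := hφs ⟨shearHom V P, subset_derivClosure (Finset.mem_image_of_mem _ hP)⟩
      (fun i => z i.succ - z 0 * v s i) (z 0)
    rw [evalAt, evalAt, eval_map_shearHom, eval_map_shearHom] at key
    have hz : (Fin.cons (z 0) fun i => z i.succ - z 0 * v s i + z 0 * V i s : Fin (k + 1) → ℝ)
        = z := by
      ext i
      refine Fin.cases ?_ (fun i => ?_) i <;> simp [hV]
    simp only [Pi.evalRingHom_apply, hz] at key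
    exact key

theorem aeval_apply_eq_eval {σ R : Type*} [CommSemiring R] (a : σ → R) (Q : MvPolynomial σ R) :
    aeval a Q = eval a Q :=
  congrFun (congrArg DFunLike.coe (coe_aeval_eq_eval a)) Q

/-! ### Generic points of images of polynomial maps -/

/-- A polynomial map attains a nonempty Zariski open part of the Zariski closure of its image. -/
theorem exists_generic_lift {σ τ : Type*} [Finite σ] [Finite τ] (g : τ → MvPolynomial σ ℂ) :
    ∃ f : MvPolynomial τ ℂ, aeval g f ≠ 0 ∧ ∀ a : τ → ℂ,
      (∀ Q : MvPolynomial τ ℂ, aeval g Q = 0 → eval a Q = 0) → eval a f ≠ 0 →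
        ∃ x, ∀ i, eval x (g i) = a i := by
  set ε : MvPolynomial τ ℂ →+* MvPolynomial σ ℂ := (aeval g).toRingHom with hε
  have hfin : ε.FiniteType := by
    refine RingHom.FiniteType.of_comp_finiteType (f := algebraMap ℂ (MvPolynomial τ ℂ)) ?_
    have : ε.comp (algebraMap ℂ (MvPolynomial τ ℂ)) = algebraMap ℂ (MvPolynomial σ ℂ) :=
      (aeval g).comp_algebraMap
    rw [this, RingHom.finiteType_algebraMap]
    infer_instance
  obtain ⟨D, hD⟩ := PrimeSpectrum.exists_constructibleSetData_iff.2
    (PrimeSpectrum.isConstructible_range_comap (RingHom.FinitePresentation.of_finiteType.1 hfin))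
  have hgen : PrimeSpectrum.comap ε ⟨⊥, Ideal.isPrime_bot⟩ ∈ D.toSet := hD ▸ ⟨_, rfl⟩
  simp only [PrimeSpectrum.ConstructibleSetData.toSet, Set.mem_iUnion] at hgen
  obtain ⟨B, hB, hgB, hfB⟩ := hgen
  refine ⟨B.f, fun h => hfB ?_, fun a ha hfa => ?_⟩
  · simpa [PrimeSpectrum.mem_zeroLocus, hε] using h
  have hmax : (vanishingIdeal ℂ {a} : Ideal (MvPolynomial τ ℂ)).IsMaximal :=
    isMaximal_iff_eq_vanishingIdeal_singleton.2 ⟨a, rfl⟩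
  have hmem : (⟨vanishingIdeal ℂ {a}, hmax.isPrime⟩ : PrimeSpectrum (MvPolynomial τ ℂ)) ∈
      Set.range (PrimeSpectrum.comap ε) := by
    rw [← hD]
    simp only [PrimeSpectrum.ConstructibleSetData.toSet, Set.mem_iUnion]
    refine ⟨B, hB, ?_, ?_⟩
    · intro Q hQ
      have h1 : ε Q = 0 := by simpa using hgB hQ
      exact (mem_vanishingIdeal_singleton_iff a Q).2 (by rw [aeval_apply_eq_eval]; exact ha Q h1)
    · intro h
      have := (mem_vanishingIdeal_singleton_iff a _).1 (h rfl)
      rw [aeval_apply_eq_eval] at this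
      exact hfa this
  obtain ⟨𝔮, h𝔮⟩ := hmem
  obtain ⟨M, hM, hle⟩ := Ideal.exists_le_maximal 𝔮.asIdeal 𝔮.isPrime.ne_top
  obtain ⟨x, rfl⟩ := isMaximal_iff_eq_vanishingIdeal_singleton.1 hM
  refine ⟨x, fun i => ?_⟩
  have h1 : X i - C (a i) ∈ (vanishingIdeal ℂ {a} : Ideal (MvPolynomial τ ℂ)) :=
    (mem_vanishingIdeal_singleton_iff a _).2 (by simp)
  have h2 : ε (X i - C (a i)) ∈ 𝔮.asIdeal := by
    have := congrArg PrimeSpectrum.asIdeal h𝔮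
    simp only [PrimeSpectrum.comap_asIdeal] at this
    rw [← this] at h1
    exact h1
  have h3 := (mem_vanishingIdeal_singleton_iff x _).1 (hle h2)
  rw [aeval_apply_eq_eval] at h3
  have h4 : ε (X i - C (a i)) = g i - C (a i) := by simp [hε, algebraMap_eq]
  rw [h4, map_sub, eval_C, sub_eq_zero] at h3
  exact h3

/-! ### Primes lying over zero in a polynomial ring -/

/-- A nonzero prime of `A[W]` meeting the factorial ring `A` trivially is principal. -/
theorem exists_prime_generator {A : Type*} [CommRing A] [IsDomain A] [UniqueFactorizationMonoid A]
    {𝔭 : Ideal (Polynomial A)} (h𝔭 : 𝔭.IsPrime) (h0 : 𝔭 ≠ ⊥)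
    (hA : ∀ a : A, Polynomial.C a ∈ 𝔭 → a = 0) :
    ∃ P ∈ 𝔭, Prime P ∧ 0 < P.natDegree ∧ ∀ Q ∈ 𝔭, P ∣ Q := by
  obtain ⟨Q, ⟨hQ, hQ0⟩, hmin⟩ : ∃ Q, (Q ∈ 𝔭 ∧ Q ≠ 0) ∧
      ∀ Q', (Q' ∈ 𝔭 ∧ Q' ≠ 0) → Q.natDegree ≤ Q'.natDegree := by
    obtain ⟨Q, hQ, hQ0⟩ := Submodule.exists_mem_ne_zero_of_ne_bot h0
    obtain ⟨Q, hQ, hmin⟩ := (measure Polynomial.natDegree).wf.has_min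
      {Q : Polynomial A | Q ∈ 𝔭 ∧ Q ≠ 0} ⟨Q, hQ, hQ0⟩
    exact ⟨Q, hQ, fun Q' hQ' => not_lt.1 (hmin Q' hQ')⟩
  obtain ⟨s, hs, hsQ⟩ := UniqueFactorizationMonoid.exists_prime_factors Q hQ0
  obtain ⟨P, hPs, hP𝔭⟩ := (h𝔭.multiset_prod_mem_iff_exists_mem s).1
    ((Ideal.mem_iff_of_associated hsQ).2 hQ)
  have hP := hs P hPs
  have hPQ : P.natDegree ≤ Q.natDegree :=
    Polynomial.natDegree_le_of_dvd ((Multiset.dvd_prod hPs).trans hsQ.dvd) hQ0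
  have hdeg : 0 < P.natDegree := by
    rw [Nat.pos_iff_ne_zero]
    intro h
    rw [Polynomial.eq_C_of_natDegree_eq_zero h] at hP𝔭
    have := hA _ hP𝔭
    exact hP.ne_zero (by rw [Polynomial.eq_C_of_natDegree_eq_zero h, this, Polynomial.C_0])
  refine ⟨P, hP𝔭, hP, hdeg, fun R hR => ?_⟩
  obtain ⟨k, s, r, hsr, hr⟩ := exists_pseudo_division P le_rfl R
  have hr𝔭 : r ∈ 𝔭 := by
    have : r = Polynomial.C (P.coeff P.natDegree) ^ k * R - P * s := by rw [hsr]; ring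
    rw [this]
    exact 𝔭.sub_mem (𝔭.mul_mem_left _ hR) (𝔭.mul_mem_right _ hP𝔭)
  have hr0 : r = 0 := by
    by_contra h
    have h1 := hmin r ⟨hr𝔭, h⟩
    have h2 := (Polynomial.natDegree_lt_iff_degree_lt h).2 hr
    omega
  rw [hr0, add_zero] at hsr
  refine (hP.dvd_or_dvd (Dvd.intro _ hsr.symm)).resolve_left fun h => ?_
  have h1 := hP.dvd_of_dvd_pow h
  have h2 := Polynomial.natDegree_le_of_dvd h1
    (Polynomial.C_ne_zero.2 (Polynomial.leadingCoeff_ne_zero.2 hP.ne_zero))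
  rw [Polynomial.natDegree_C] at h2
  omega

/-- A prime `P` of positive degree and a non-multiple `f` generate an ideal meeting the
coefficient ring. -/
theorem exists_C_mem_span_pair {A : Type*} [CommRing A] [IsDomain A] [UniqueFactorizationMonoid A]
    {P f : Polynomial A} (hP : Prime P) (hf : ¬ P ∣ f) :
    ∃ b : A, b ≠ 0 ∧ Polynomial.C b ∈ Ideal.span {P, f} := by
  by_contra! h
  obtain ⟨𝔮, h𝔮, hle, hdis⟩ := Ideal.exists_le_prime_disjoint (Ideal.span {P, f})
    ((nonZeroDivisors A).map (Polynomial.C : A →+* Polynomial A)) (by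
      rw [Set.disjoint_left]
      rintro _ hx ⟨b, hb, rfl⟩
      exact h b (nonZeroDivisors.ne_zero hb) hx)
  have hP𝔮 : P ∈ 𝔮 := hle (Ideal.subset_span (by simp))
  have hf𝔮 : f ∈ 𝔮 := hle (Ideal.subset_span (by simp))
  obtain ⟨P', hP', hprime, -, hdvd⟩ := exists_prime_generator h𝔮
    (fun h => hP.ne_zero (by simpa [h] using hP𝔮)) (fun a ha => by
      by_contra h0
      exact Set.disjoint_left.1 hdis ha ⟨a, mem_nonZeroDivisors_of_ne_zero h0, rfl⟩)
  exact hf (((hprime.associated_of_dvd hP (hdvd P hP𝔮)).symm.dvd).trans (hdvd f hf𝔮))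

/-- The complement of a hypersurface is dense. -/
theorem dense_eval_ne_zero {r : ℕ} {Q : MvPolynomial (Fin r) ℂ} (hQ : Q ≠ 0) :
    Dense {y : Fin r → ℂ | eval y Q ≠ 0} := by
  rw [Metric.dense_iff]
  intro y ε hε
  by_contra hne
  rw [Set.not_nonempty_iff_eq_empty] at hne
  apply hQ
  refine MvPolynomial.funext_set (fun i => Metric.ball (y i) ε) (fun i => ?_) fun x hx => ?_
  · exact infinite_of_mem_nhds (y i) (Metric.ball_mem_nhds _ hε)
  · by_contra h0
    rw [map_zero] at h0
    have : x ∈ Metric.ball y ε ∩ {y | eval y Q ≠ 0} := ⟨by rwa [ball_pi _ hε], h0⟩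
    rw [hne] at this
    exact this

/-- A primitive-type criterion: if the leading coefficient of an irreducible `P` vanishes only
where all coefficients vanish, then it is a unit. -/
theorem isUnit_leadingCoeff {r : ℕ} {P : Polynomial (MvPolynomial (Fin r) ℂ)} (hP : Prime P)
    (hdeg : 0 < P.natDegree)
    (h : ∀ y : Fin r → ℂ, eval y P.leadingCoeff = 0 → ∀ i, eval y (P.coeff i) = 0) :
    IsUnit P.leadingCoeff := by
  by_contra hu
  obtain ⟨π, hπ, hdvd⟩ := WfDvdMonoid.exists_irreducible_factor hu
    (Polynomial.leadingCoeff_ne_zero.2 hP.ne_zero)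
  have hprime : (Ideal.span {π}).IsPrime :=
    (Ideal.span_singleton_prime hπ.ne_zero).2 hπ.prime
  have hcoeff : ∀ i, π ∣ P.coeff i := by
    intro i
    rw [← Ideal.mem_span_singleton,
      ← MvPolynomial.IsPrime.vanishingIdeal_zeroLocus (K := ℂ) (Ideal.span {π})]
    intro y hy
    rw [aeval_apply_eq_eval]
    refine h y ?_ i
    have := hy P.leadingCoeff (Ideal.mem_span_singleton.2 hdvd)
    rwa [aeval_apply_eq_eval] at this
  obtain ⟨T, hT⟩ := (Polynomial.C_dvd_iff_dvd_coeff π P).2 hcoeff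
  rcases hP.irreducible.isUnit_or_isUnit hT with h1 | h1
  · exact hπ.not_isUnit (Polynomial.isUnit_C.1 h1)
  · rw [hT, Polynomial.natDegree_C_mul hπ.ne_zero, Polynomial.natDegree_eq_zero_of_isUnit h1] at hdeg
    exact lt_irrefl _ hdeg

/-! ### Integrality from boundedness -/

theorem aeval_cons_eq_eval₂ {n r : ℕ} (G : Fin r → MvPolynomial (Fin n) ℂ)
    (u : MvPolynomial (Fin n) ℂ) (Q : MvPolynomial (Fin (r + 1)) ℂ) :
    aeval (Fin.cons u G : Fin (r + 1) → MvPolynomial (Fin n) ℂ) Q =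
      (finSuccEquiv ℂ r Q).eval₂ (aeval G).toRingHom u := by
  have := eval₂Hom_cons (algebraMap ℂ (MvPolynomial (Fin n) ℂ)) u G Q
  rw [Polynomial.eval_map] at this
  exact this

/-- The coefficients of a polynomial are bounded in terms of its roots and its
leading coefficient. -/
theorem Polynomial.norm_coeff_le_of_roots_le {p : Polynomial ℂ} (hp : p ≠ 0) {B : ℝ}
    (h : ∀ w, p.eval w = 0 → ‖w‖ ≤ B) (i : ℕ) :
    ‖p.coeff i‖ ≤ max B 1 ^ p.natDegree * p.natDegree.choose (p.natDegree / 2) *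
      ‖p.leadingCoeff‖ := by
  have hlc : p.leadingCoeff ≠ 0 := leadingCoeff_ne_zero.2 hp
  have h1 := Polynomial.coeff_bdd_of_roots_le (f := RingHom.id ℂ) (p := p * C p.leadingCoeff⁻¹)
    (d := p.natDegree) (B := B) (monic_mul_leadingCoeff_inv hp) (IsAlgClosed.splits _)
    (natDegree_mul_C (inv_ne_zero hlc)).le (fun z hz => by
      refine h z ?_
      have := (mem_roots'.1 hz).2
      simpa [IsRoot, hp] using this) i
  rw [map_id, coeff_mul_C, norm_mul, norm_inv] at h1
  have h2 : 0 < ‖p.leadingCoeff‖ := norm_pos_iff.2 hlc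
  have h3 := mul_le_mul_of_nonneg_right h1 h2.le
  rwa [mul_assoc, inv_mul_cancel₀ h2.ne', mul_one] at h3

/-- If `u` is bounded wherever the algebraically independent `G` are bounded, then `u` is integral
over the ring they generate, and all relations are multiples of a single one. -/
theorem exists_integral_relation {n r : ℕ} {G : Fin r → MvPolynomial (Fin n) ℂ}
    (hG : AlgebraicIndependent ℂ G) {u : MvPolynomial (Fin n) ℂ}
    (hu : ∀ M : ℝ, ∃ M' : ℝ, ∀ x, ‖fun i => eval x (G i)‖ ≤ M → ‖eval x u‖ ≤ M') :
    ∃ P : Polynomial (MvPolynomial (Fin r) ℂ), IsUnit P.leadingCoeff ∧ 0 < P.natDegree ∧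
      ∀ Q : Polynomial (MvPolynomial (Fin r) ℂ),
        Q.eval₂ (aeval G).toRingHom u = 0 ↔ P ∣ Q := by
  obtain ⟨f, hf, hlift⟩ := exists_generic_lift (Fin.cons u G : Fin (r + 1) → MvPolynomial (Fin n) ℂ)
  set 𝔭 : Ideal (Polynomial (MvPolynomial (Fin r) ℂ)) :=
    RingHom.ker (Polynomial.eval₂RingHom (aeval G).toRingHom u) with h𝔭
  have hmem : ∀ Q, Q ∈ 𝔭 ↔ Q.eval₂ (aeval G).toRingHom u = 0 := fun Q => Iff.rfl
  have hprime : 𝔭.IsPrime := RingHom.ker_isPrime _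
  set F := finSuccEquiv ℂ r f
  have hF : F ∉ 𝔭 := by rwa [hmem, ← aeval_cons_eq_eval₂]
  have hlift' : ∀ (y : Fin r → ℂ) (w : ℂ), (∀ Q ∈ 𝔭, (Q.map (eval y)).eval w = 0) →
      (F.map (eval y)).eval w ≠ 0 → ∃ x, eval x u = w ∧ ∀ i, eval x (G i) = y i := by
    intro y w h1 h2
    obtain ⟨x, hx⟩ := hlift (Fin.cons w y) (fun Q hQ => by
      rw [eval_eq_eval_mv_eval']
      exact h1 _ ((hmem _).2 (by rwa [← aeval_cons_eq_eval₂]))) (by rwa [eval_eq_eval_mv_eval'])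
    exact ⟨x, by simpa using hx 0, fun i => by simpa using hx i.succ⟩
  have hA : ∀ a, Polynomial.C a ∈ 𝔭 → a = 0 := by
    intro a ha
    rw [hmem, Polynomial.eval₂_C] at ha
    exact (injective_iff_map_eq_zero _).1 hG a ha
  have hbot : 𝔭 ≠ ⊥ := by
    intro hbot
    have hF0 : F ≠ 0 := fun h => hF (h ▸ 𝔭.zero_mem)
    obtain ⟨y, hy⟩ : ∃ y, eval y F.leadingCoeff ≠ 0 := by
      by_contra! h
      exact Polynomial.leadingCoeff_ne_zero.2 hF0 (MvPolynomial.funext fun y => by simpa using h y)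
    obtain ⟨M', hM'⟩ := hu ‖y‖
    set p := F.map (eval y)
    have hp : p ≠ 0 := fun h => hy (by
      rw [Polynomial.leadingCoeff, ← Polynomial.coeff_map]
      change p.coeff _ = 0
      rw [h, Polynomial.coeff_zero])
    set t : ℝ := max |M'| p.cauchyBound + 1
    have ht : ‖(t : ℂ)‖ = t := by
      rw [Complex.norm_real, Real.norm_of_nonneg]
      have := (abs_nonneg M').trans (le_max_left _ (p.cauchyBound : ℝ))
      positivity
    obtain ⟨x, hx, hxG⟩ := hlift' y t (fun Q hQ => by
      rw [hbot, Ideal.mem_bot] at hQ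
      simp [hQ]) (fun h => by
        have h1 : ‖(t : ℂ)‖ < p.cauchyBound := by
          exact_mod_cast Polynomial.IsRoot.norm_lt_cauchyBound hp h
        have := le_max_right |M'| (p.cauchyBound : ℝ)
        rw [ht] at h1
        linarith)
    have h1 := hM' x (by rw [_root_.funext hxG])
    rw [hx, ht] at h1
    have := (le_abs_self M').trans (le_max_left |M'| (p.cauchyBound : ℝ))
    linarith
  obtain ⟨P, hP𝔭, hP, hdeg, hdvd⟩ := exists_prime_generator hprime hbot hA
  have hiff : ∀ Q, Q ∈ 𝔭 ↔ P ∣ Q := fun Q =>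
    ⟨hdvd Q, fun ⟨T, hT⟩ => hT ▸ 𝔭.mul_mem_right _ hP𝔭⟩
  refine ⟨P, isUnit_leadingCoeff hP hdeg fun y hy i => ?_, hdeg, fun Q => by rw [← hmem, hiff]⟩
  obtain ⟨b, hb0, hb⟩ := exists_C_mem_span_pair hP (fun h => hF ((hiff F).2 h))
  obtain ⟨β, α, hαβ⟩ := Ideal.mem_span_pair.1 hb
  obtain ⟨M', hM'⟩ := hu (‖y‖ + 1)
  set K : ℝ := max M' 1 ^ P.natDegree * P.natDegree.choose (P.natDegree / 2)
  have hgen : ∀ z ∈ Metric.ball y 1 ∩ {z | eval z (b * P.leadingCoeff) ≠ 0},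
      ‖eval z (P.coeff i)‖ ≤ K * ‖eval z P.leadingCoeff‖ := by
    rintro z ⟨hzy, hz⟩
    rw [Set.mem_ofPred_eq, map_mul, mul_ne_zero_iff] at hz
    have hnat : (P.map (eval z)).natDegree = P.natDegree :=
      Polynomial.natDegree_map_of_leadingCoeff_ne_zero _ hz.2
    have hlc : (P.map (eval z)).leadingCoeff = eval z P.leadingCoeff :=
      Polynomial.leadingCoeff_map_of_leadingCoeff_ne_zero _ hz.2
    have := Polynomial.norm_coeff_le_of_roots_le (p := P.map (eval z)) (B := M')
      (Polynomial.leadingCoeff_ne_zero.1 (hlc ▸ hz.2)) (fun w hw => by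
        obtain ⟨x, hx, hxG⟩ := hlift' z w (fun Q hQ => by
          obtain ⟨T, rfl⟩ := (hiff Q).1 hQ
          rw [Polynomial.map_mul, Polynomial.eval_mul, hw, zero_mul]) (fun h => hz.1 (by
            have := congrArg (fun q => (q.map (eval z)).eval w) hαβ
            simpa [hw, h] using this.symm))
        rw [← hx]
        refine hM' x ?_
        rw [_root_.funext hxG]
        have h1 : ‖z - y‖ < 1 := by rwa [← dist_eq_norm]
        have h2 := norm_le_norm_add_norm_sub' z y
        linarith) i
    rwa [hnat, hlc, Polynomial.coeff_map] at this
  have hclosed : IsClosed {z : Fin r → ℂ | ‖eval z (P.coeff i)‖ ≤ K * ‖eval z P.leadingCoeff‖} :=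
    isClosed_le (MvPolynomial.continuous_eval _).norm
      (continuous_const.mul (MvPolynomial.continuous_eval _).norm)
  have hy' := (dense_eval_ne_zero (mul_ne_zero hb0
    (Polynomial.leadingCoeff_ne_zero.2 hP.ne_zero))).open_subset_closure_inter Metric.isOpen_ball
      (Metric.mem_ball_self (x := y) one_pos)
  have := hclosed.closure_subset_iff.2 hgen hy'
  rw [Set.mem_ofPred_eq, hy, norm_zero, mul_zero] at this
  exact norm_le_zero_iff.1 this

/-! ### Relations of bounded degree -/

/-- Any `n + 1` polynomials of bounded degree in `n` variables satisfy an algebraic relation of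
bounded degree. -/
theorem exists_bounded_relation (n k : ℕ) : ∃ D : ℕ, ∀ g : Fin (n + 1) → MvPolynomial (Fin n) ℂ,
    (∀ i, (g i).totalDegree ≤ k) →
      ∃ Q : MvPolynomial (Fin (n + 1)) ℂ, Q ≠ 0 ∧ Q.totalDegree ≤ D ∧ aeval g Q = 0 := by
  set c := k * (n + 1) + 1
  set E := c ^ n + 1
  refine ⟨(n + 1) * E, fun g hg => ?_⟩
  set K := k * ((n + 1) * E)
  let e : (Fin (n + 1) → Fin E) → (Fin (n + 1) →₀ ℕ) := fun a =>
    Finsupp.equivFunOnFinite.symm fun i => (a i : ℕ)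
  have he : Function.Injective e := fun a b h => by
    funext i
    exact Fin.ext (congrFun (Finsupp.equivFunOnFinite.symm.injective h) i)
  let T : ((Fin (n + 1) → Fin E) → ℂ) →ₗ[ℂ] MvPolynomial (Fin (n + 1)) ℂ :=
    Fintype.linearCombination ℂ fun a => monomial (e a) 1
  have hT : Function.Injective T := by
    have := ((basisMonomials (Fin (n + 1)) ℂ).linearIndependent.comp e he).fintypeLinearCombination_injective
    simpa [T, coe_basisMonomials, Function.comp_def] using this
  have hsum : ∀ a : Fin (n + 1) → Fin E, ∑ i, (a i).val ≤ (n + 1) * E := fun a => by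
    refine (Finset.sum_le_card_nsmul _ _ E fun i _ => (a i).2.le).trans ?_
    simp
  let L : ((Fin (n + 1) → Fin E) → ℂ) →ₗ[ℂ] ((Fin n → Fin (K + 1)) → ℂ) :=
    LinearMap.pi (fun d => lcoeff ℂ (Finsupp.equivFunOnFinite.symm fun i => (d i : ℕ))) ∘ₗ
      (aeval g).toLinearMap ∘ₗ T
  have hker : LinearMap.ker L ≠ ⊥ := by
    refine LinearMap.ker_ne_bot_of_finrank_lt ?_
    simp only [Module.finrank_fintype_fun_eq_card, Fintype.card_fun, Fintype.card_fin]
    calc (K + 1) ^ n ≤ (c * E) ^ n := by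
          refine Nat.pow_le_pow_left ?_ n
          simp only [K, c]
          nlinarith [Nat.zero_le (c ^ n), show E = c ^ n + 1 from rfl]
      _ = c ^ n * E ^ n := mul_pow _ _ _
      _ < E * E ^ n := Nat.mul_lt_mul_of_pos_right (Nat.lt_succ_self _) (by positivity)
      _ = E ^ (n + 1) := (pow_succ' _ _).symm
  obtain ⟨v, hv, hv0⟩ := Submodule.exists_mem_ne_zero_of_ne_bot hker
  have hTv : T v = ∑ a, v a • monomial (e a) 1 := rfl
  refine ⟨T v, fun h => hv0 (hT (h.trans (map_zero T).symm)), ?_, ?_⟩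
  · rw [hTv]
    refine totalDegree_finsetSum_le fun a _ => (totalDegree_smul_le _ _).trans ?_
    rw [totalDegree_monomial _ one_ne_zero, Finsupp.sum_fintype _ _ fun _ => rfl]
    exact hsum a
  have hdeg : (aeval g (T v)).totalDegree ≤ K := by
    rw [hTv, map_sum]
    refine totalDegree_finsetSum_le fun a _ => ?_
    rw [map_smul, aeval_monomial, map_one, one_mul, Finsupp.prod_fintype _ _ fun _ => pow_zero _]
    refine (totalDegree_smul_le _ _).trans ((totalDegree_finsetProd _ _).trans ?_)
    calc ∑ i, (g i ^ e a i).totalDegree ≤ ∑ i, k * (a i).val := Finset.sum_le_sum fun i _ =>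
          (totalDegree_pow _ _).trans ((Nat.mul_le_mul_left _ (hg i)).trans (mul_comm _ _).le)
      _ = k * ∑ i, (a i).val := (Finset.mul_sum _ _ _).symm
      _ ≤ K := Nat.mul_le_mul_left _ (hsum a)
  ext d
  rw [coeff_zero]
  by_cases hd : ∀ i, d i < K + 1
  · have := congrFun (LinearMap.mem_ker.1 hv) fun i => ⟨d i, hd i⟩
    have hd' : Finsupp.equivFunOnFinite.symm (fun i => d i) = d :=
      Finsupp.equivFunOnFinite.symm_apply_apply d
    simpa [L, hd'] using this
  · push Not at hd
    obtain ⟨i, hi⟩ := hd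
    refine coeff_eq_zero_of_totalDegree_lt (hdeg.trans_lt ?_)
    have h1 : d i ≤ ∑ j ∈ d.support, d j := by
      by_cases h : i ∈ d.support
      · exact Finset.single_le_sum (f := fun j => d j) (fun _ _ => Nat.zero_le _) h
      · rw [Finsupp.notMem_support_iff.1 h]; exact Nat.zero_le _
    omega

/-! ### Noether normalisation by linear projections -/

/-- Roots of a polynomial with constant leading coefficient are locally bounded. -/
theorem exists_bound_of_root {r : ℕ} {p : Polynomial (MvPolynomial (Fin r) ℂ)} {c : ℂ} (hc : c ≠ 0)
    (hp : p.leadingCoeff = C c) (M : ℝ) :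
    ∃ W : ℝ, 0 ≤ W ∧ ∀ u : Fin r → ℂ, ‖u‖ ≤ M → ∀ w, (p.map (eval u)).eval w = 0 → ‖w‖ ≤ W := by
  have hlc : ∀ u, eval u p.leadingCoeff ≠ 0 := fun u => by rwa [hp, eval_C]
  have hcont : Continuous fun u : Fin r → ℂ => (p.map (eval u)).cauchyBound := by
    have : (fun u : Fin r → ℂ => (p.map (eval u)).cauchyBound) = fun u =>
        (Finset.range p.natDegree).sup (fun n => ‖eval u (p.coeff n)‖₊) /
          ‖eval u p.leadingCoeff‖₊ + 1 := by
      ext u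
      rw [Polynomial.cauchyBound, Polynomial.natDegree_map_of_leadingCoeff_ne_zero _ (hlc u),
        Polynomial.leadingCoeff_map_of_leadingCoeff_ne_zero _ (hlc u)]
      simp only [Polynomial.coeff_map]
    rw [this]
    refine (Continuous.div₀ ?_ (MvPolynomial.continuous_eval _).nnnorm fun u => ?_).add
      continuous_const
    · exact Continuous.finset_sup_apply fun n _ => (MvPolynomial.continuous_eval _).nnnorm
    · exact nnnorm_ne_zero_iff.2 (hlc u)
  obtain ⟨W, hW⟩ := (isCompact_closedBall (0 : Fin r → ℂ) M).exists_bound_of_continuousOn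
    (NNReal.continuous_coe.comp hcont).continuousOn
  refine ⟨|W|, abs_nonneg W, fun u hu w hw => ?_⟩
  have h1 : ‖w‖ < (p.map (eval u)).cauchyBound := by
    exact_mod_cast Polynomial.IsRoot.norm_lt_cauchyBound (p := p.map (eval u))
      (fun h => hlc u (by
        rw [← Polynomial.leadingCoeff_map_of_leadingCoeff_ne_zero _ (hlc u), h,
          Polynomial.leadingCoeff_zero])) hw
  have h2 := hW u (mem_closedBall_zero_iff.2 hu)
  exact h1.le.trans ((le_abs_self _).trans (h2.trans (le_abs_self W)))

/-- The preimages of bounded sets under a polynomial map are bounded. -/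
def BoundedFibers {n : ℕ} {ι : Type*} [Fintype ι] (P : ι → MvPolynomial (Fin n) ℂ) : Prop :=
  ∀ M : ℝ, ∃ R : ℝ, ∀ x : Fin n → ℂ, ‖fun i => eval x (P i)‖ ≤ M → ‖x‖ ≤ R

/-- Linear combinations of a family of polynomials. -/
noncomputable def linComb {n m r : ℕ} (c : Fin r → Fin m → ℂ) (P : Fin m → MvPolynomial (Fin n) ℂ) :
    Fin r → MvPolynomial (Fin n) ℂ :=
  fun a => ∑ b, C (c a b) * P b

/-- A relation between the components allows to drop one of them after a generic projection. -/
theorem BoundedFibers.drop {n r : ℕ} {G : Fin (r + 1) → MvPolynomial (Fin n) ℂ}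
    (hG : BoundedFibers G) {Q : MvPolynomial (Fin (r + 1)) ℂ} (hQ : Q ≠ 0) (hQG : aeval G Q = 0) :
    ∃ v : Fin r → ℂ, BoundedFibers fun i => G i.succ - C (v i) * G 0 := by
  obtain ⟨v, hv⟩ := exists_shear {Q}
  obtain ⟨c, hc, hdeg, hcoeff⟩ := hv Q (Finset.mem_singleton_self _) hQ
  have hlc : (shearHom v Q).leadingCoeff = C c := by
    have : (shearHom v Q).natDegree = Q.totalDegree := by
      refine le_antisymm hdeg (Polynomial.le_natDegree_of_ne_zero ?_)
      rw [hcoeff]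
      exact C_ne_zero.2 hc
    rw [Polynomial.leadingCoeff, this, hcoeff]
  refine ⟨v, fun M => ?_⟩
  obtain ⟨W, hW0, hW⟩ := exists_bound_of_root hc hlc M
  obtain ⟨M', hM'⟩ := hG (max W (|M| + W * ‖v‖))
  refine ⟨M', fun x hx => hM' x ?_⟩
  set u : Fin r → ℂ := fun i => eval x (G i.succ - C (v i) * G 0) with hu
  have hGx : (Fin.cons (eval x (G 0)) fun i => u i + eval x (G 0) * v i : Fin (r + 1) → ℂ) =
      fun i => eval x (G i) := by
    funext i
    refine Fin.cases rfl (fun i => ?_) i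
    simp only [Fin.cons_succ, hu, map_sub, map_mul, eval_C]
    ring
  have hroot : ((shearHom v Q).map (eval u)).eval (eval x (G 0)) = 0 := by
    have := eval_map_shearHom (RingHom.id ℂ) v u (eval x (G 0)) Q
    simp only [RingHom.id_apply] at this
    rw [hGx] at this
    refine this.trans ?_
    have h1 : eval x (aeval G Q) = eval (fun i => eval x (G i)) Q := by
      rw [← aeval_apply_eq_eval, ← aeval_apply_eq_eval, ← AlgHom.comp_apply, comp_aeval]
      rfl
    rw [hQG, map_zero] at h1
    exact h1.symm
  have hw := hW u hx _ hroot
  rw [← hGx, pi_norm_le_iff_of_nonneg (hW0.trans (le_max_left _ _))]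
  intro i
  refine Fin.cases (hw.trans (le_max_left _ _)) (fun i => ?_) i
  rw [Fin.cons_succ]
  refine (norm_add_le _ _).trans (le_trans ?_ (le_max_right _ _))
  rw [norm_mul]
  exact add_le_add (((norm_le_pi_norm u i).trans hx).trans (le_abs_self M))
    (mul_le_mul hw (norm_le_pi_norm v i) (norm_nonneg _) hW0)

/-- A proper polynomial map stays proper after a suitable projection with algebraically independent
components. -/
theorem BoundedFibers.exists_linComb {n m : ℕ} {P : Fin m → MvPolynomial (Fin n) ℂ}
    (hP : BoundedFibers P) : ∃ (r : ℕ) (c : Fin r → Fin m → ℂ),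
      BoundedFibers (linComb c P) ∧ AlgebraicIndependent ℂ (linComb c P) := by
  classical
  have hex : ∃ r, ∃ c : Fin r → Fin m → ℂ, BoundedFibers (linComb c P) := by
    refine ⟨m, fun a => Pi.single a 1, ?_⟩
    have : linComb (fun a => Pi.single a 1) P = P := by
      funext a
      rw [linComb, Finset.sum_eq_single a] <;> simp +contextual
    rwa [this]
  obtain ⟨c, hc⟩ := Nat.find_spec hex
  refine ⟨_, c, hc, ?_⟩
  have hmin := fun r h => Nat.find_min hex (m := r) h
  generalize Nat.find hex = r at c hmin
  cases r with
  | zero => exact algebraicIndependent_empty_type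
  | succ r =>
    by_contra h
    rw [algebraicIndependent_iff] at h
    push Not at h
    obtain ⟨Q, hQ, hQ0⟩ := h
    obtain ⟨v, hv⟩ := hc.drop hQ0 hQ
    refine hmin r (Nat.lt_succ_self r) ⟨fun i b => c i.succ b - v i * c 0 b, ?_⟩
    convert hv using 2 with i
    simp only [linComb, map_sub, map_mul, sub_mul, Finset.sum_sub_distrib, Finset.mul_sum, mul_assoc]

theorem linComb_eval {n m r : ℕ} (c : Fin r → Fin m → ℂ) (P : Fin m → MvPolynomial (Fin n) ℂ)
    (x : Fin n → ℂ) (a : Fin r) : eval x (linComb c P a) = ∑ b, c a b * eval x (P b) := by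
  simp [linComb]

theorem BoundedFibers.exists_integral_relation {n r : ℕ} {G : Fin r → MvPolynomial (Fin n) ℂ}
    (hG : BoundedFibers G) (hind : AlgebraicIndependent ℂ G) (j : Fin n) :
    ∃ P : Polynomial (MvPolynomial (Fin r) ℂ), IsUnit P.leadingCoeff ∧ 0 < P.natDegree ∧
      ∀ Q : Polynomial (MvPolynomial (Fin r) ℂ),
        Q.eval₂ (aeval G).toRingHom (X j) = 0 ↔ P ∣ Q := by
  refine _root_.exists_integral_relation hind fun M => ?_
  obtain ⟨M', hM'⟩ := hG M
  refine ⟨M', fun x hx => ?_⟩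
  rw [eval_X]
  exact (norm_le_pi_norm x j).trans (hM' x hx)

theorem BoundedFibers.card_eq {n r : ℕ} {G : Fin r → MvPolynomial (Fin n) ℂ}
    (hG : BoundedFibers G) (hind : AlgebraicIndependent ℂ G) : r = n := by
  have hFint : ((aeval G).toRingHom : MvPolynomial (Fin r) ℂ →+* MvPolynomial (Fin n) ℂ).IsIntegral := by
    intro f
    induction f using MvPolynomial.induction_on with
    | C a => exact ⟨Polynomial.X - Polynomial.C (C a), Polynomial.monic_X_sub_C _, by simp [algebraMap_eq]⟩
    | add p q hp hq => exact RingHom.IsIntegralElem.add _ hp hq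
    | mul_X p j hp =>
      refine RingHom.IsIntegralElem.mul _ hp ?_
      obtain ⟨P, hlc, -, hP⟩ := hG.exists_integral_relation hind j
      obtain ⟨u, hu⟩ := hlc
      refine ⟨Polynomial.C (↑u⁻¹ : MvPolynomial (Fin r) ℂ) * P, ?_, ?_⟩
      · exact Polynomial.monic_C_mul_of_mul_leadingCoeff_eq_one (by rw [← hu]; simp)
      · rw [Polynomial.eval₂_mul, (hP P).2 dvd_rfl, mul_zero]
  have halg : Algebra.IsAlgebraic (Algebra.adjoin ℂ (Set.range G)) (MvPolynomial (Fin n) ℂ) := by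
    refine ⟨fun f => ?_⟩
    refine IsIntegral.isAlgebraic ?_
    obtain ⟨p, hp, hpf⟩ := hFint f
    have hmem : ∀ Q, aeval G Q ∈ Algebra.adjoin ℂ (Set.range G) := fun Q => by
      rw [Algebra.adjoin_range_eq_range_aeval]
      exact ⟨Q, rfl⟩
    refine ⟨p.map ((aeval G).codRestrict _ hmem).toRingHom, hp.map _, ?_⟩
    rw [Polynomial.eval₂_map]
    exact hpf
  have := (hind.isTranscendenceBasis_iff_isAlgebraic.2 halg).lift_cardinalMk_eq
    (IsTranscendenceBasis.mvPolynomial (Fin n) ℂ)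
  simpa using this

theorem totalDegree_linComb_le {n m r k : ℕ} (c : Fin r → Fin m → ℂ)
    {P : Fin m → MvPolynomial (Fin n) ℂ} (hP : ∀ i, (P i).totalDegree ≤ k) (a : Fin r) :
    (linComb c P a).totalDegree ≤ k := by
  refine totalDegree_finsetSum_le fun b _ => ?_
  rw [C_mul']
  exact (totalDegree_smul_le _ _).trans (hP b)

/-- The coordinates are integral over a projection of a proper polynomial map, with relations of
uniformly bounded degree. -/
theorem exists_uniform_integral_relation (n m k : ℕ) : ∃ D : ℕ,
    ∀ P : Fin m → MvPolynomial (Fin n) ℂ, (∀ i, (P i).totalDegree ≤ k) → BoundedFibers P →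
      ∃ (c : Fin n → Fin m → ℂ) (q : Fin n → Fin D → MvPolynomial (Fin n) ℂ),
        (∀ j i, (q j i).totalDegree ≤ D) ∧ ∀ x j,
          x j ^ D + ∑ i : Fin D, eval (fun a => ∑ b, c a b * eval x (P b)) (q j i) *
            x j ^ (i : ℕ) = 0 := by
  obtain ⟨D, hD⟩ := exists_bounded_relation n (max k 1)
  refine ⟨D, fun P hk hP => ?_⟩
  obtain ⟨r, c, hc, hind⟩ := hP.exists_linComb
  obtain rfl := hc.card_eq hind
  set G := linComb c P with hG
  refine ⟨c, ?_⟩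
  have key : ∀ j, ∃ T : Polynomial (MvPolynomial (Fin r) ℂ), T.Monic ∧ T.natDegree = D ∧
      (∀ i, (T.coeff i).totalDegree ≤ D) ∧ T.eval₂ (aeval G).toRingHom (X j) = 0 := by
    intro j
    obtain ⟨T, hlc, -, hT⟩ := hc.exists_integral_relation hind j
    obtain ⟨Q, hQ0, hQD, hQ⟩ := hD (Fin.cons (X j) G) (fun i => by
      refine Fin.cases ?_ (fun i => ?_) i
      · simp
      · rw [Fin.cons_succ]
        exact (totalDegree_linComb_le c hk i).trans (le_max_left _ _))
    rw [aeval_cons_eq_eval₂, hT] at hQ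
    set S := (finSuccEquiv ℂ r).symm T with hS
    have hST : finSuccEquiv ℂ r S = T := by simp [hS]
    have hSQ : S ∣ Q := by
      have := map_dvd (finSuccEquiv ℂ r).symm hQ
      rwa [AlgEquiv.symm_apply_apply] at this
    have hSD := (totalDegree_le_of_dvd_of_isDomain hSQ hQ0).trans hQD
    have hcoeff : ∀ i, T.coeff i ≠ 0 → (T.coeff i).totalDegree + i ≤ D := fun i hi => by
      have := totalDegree_coeff_finSuccEquiv_add_le S i
      rw [hST] at this
      exact (this hi).trans hSD
    obtain ⟨a, ha, haT⟩ := isUnit_iff_eq_C_of_isReduced.1 hlc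
    have ha0 : a ≠ 0 := ha.ne_zero
    have hdeg : T.natDegree ≤ D :=
      le_of_add_le_right (hcoeff T.natDegree hlc.ne_zero)
    have hmonic : (Polynomial.C (C a⁻¹) * T).Monic :=
      Polynomial.monic_C_mul_of_mul_leadingCoeff_eq_one (by
        rw [haT, ← C_mul, inv_mul_cancel₀ ha0, C_1])
    refine ⟨Polynomial.C (C a⁻¹) * T * Polynomial.X ^ (D - T.natDegree),
      hmonic.mul (Polynomial.monic_X_pow _), ?_, fun i => ?_, ?_⟩
    · rw [hmonic.natDegree_mul (Polynomial.monic_X_pow _), Polynomial.natDegree_X_pow,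
        Polynomial.natDegree_C_mul (C_ne_zero.2 (inv_ne_zero ha0))]
      omega
    · rw [Polynomial.coeff_mul_X_pow']
      split_ifs
      · rw [Polynomial.coeff_C_mul, C_mul']
        refine (totalDegree_smul_le _ _).trans ?_
        by_cases h : T.coeff (i - (D - T.natDegree)) = 0
        · rw [h]; simp
        · exact le_of_add_le_left (hcoeff _ h)
      · simp
    · rw [Polynomial.eval₂_mul, Polynomial.eval₂_mul, (hT T).2 dvd_rfl, mul_zero, zero_mul]
  choose T hmonic hnat hdeg hT using key
  refine ⟨fun j i => (T j).coeff i, fun j i => hdeg j i, fun x j => ?_⟩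
  have h := congrArg (eval x) (hT j)
  rw [Polynomial.eval₂_eq_sum_range, hnat, Finset.sum_range_succ, Finset.sum_range, map_add,
    map_sum, map_zero, add_comm] at h
  have hev : ∀ Q : MvPolynomial (Fin r) ℂ, eval x (aeval G Q) =
      eval (fun a => ∑ b, c a b * eval x (P b)) Q := fun Q => by
    have : (fun a => ∑ b, c a b * eval x (P b)) = fun a => eval x (G a) :=
      _root_.funext fun a => (linComb_eval c P x a).symm
    rw [this, ← aeval_apply_eq_eval, ← aeval_apply_eq_eval, ← AlgHom.comp_apply, comp_aeval]
    rfl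
  have hone : (T j).coeff D = 1 := by rw [← hnat j]; exact hmonic j
  simp only [AlgHom.toRingHom_eq_coe, RingHom.coe_coe, map_mul, map_pow, eval_X, hev, hone,
    map_one, one_mul] at h
  exact h

/-! ### Lifting homeomorphisms along finite polynomial maps -/

section Lift

variable {S : Type*} {N M : ℕ} {f : S → (Fin N → ℝ) → (Fin M → ℝ)}
  {p : Fin M → MvPolynomial (Fin N) (S → ℝ)}
  {ρ : Fin N → Polynomial (MvPolynomial (Fin M) (S → ℝ))}

/-- Polynomials describing the graph of a family of maps and the signs of the polynomials in `F`
at the coordinates of a point. -/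
noncomputable def graphPolys (p : Fin M → MvPolynomial (Fin N) (S → ℝ))
    (F : Finset (Polynomial (MvPolynomial (Fin M) (S → ℝ)))) :
    Finset (MvPolynomial (Fin N) (MvPolynomial (Fin M) (S → ℝ))) := by
  classical exact
    (F ×ˢ Finset.univ).image (fun z : _ × Fin N => z.1.eval₂ C (X z.2)) ∪
      Finset.univ.image fun j => (p j).map C - C (X j)

theorem exists_signAgree_fiber (hf : ∀ s x j, f s x j = evalAt s x (p j))
    {F : Finset (Polynomial (MvPolynomial (Fin M) (S → ℝ)))} {s s' : S} {x x' : Fin N → ℝ}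
    {y' : Fin M → ℝ}
    (h : SignAgree (graphPolys p F : Set (MvPolynomial (Fin N) (MvPolynomial (Fin M) (S → ℝ))))
      (eval₂Hom (evalAt s (f s x)) x) (eval₂Hom (evalAt s' y') x')) :
    f s' x' = y' ∧ ∀ q ∈ F, ∀ i, SignType.sign ((q.map (evalAt s (f s x))).eval (x i)) =
      SignType.sign ((q.map (evalAt s' y')).eval (x' i)) := by
  classical
  have hev : ∀ (t : S) (z : Fin N → ℝ) (w : Fin M → ℝ) j,
      eval₂Hom (evalAt t w) z ((p j).map C - C (X j)) = f t z j - w j := by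
    intro t z w j
    have : (evalAt t w).comp C = Pi.evalRingHom (fun _ => ℝ) t := by
      ext a; simp [evalAt]
    rw [map_sub, coe_eval₂Hom, eval₂_map, this, eval₂_C, hf]
    simp [evalAt]
  have hev' : ∀ (t : S) (z : Fin N → ℝ) (w : Fin M → ℝ)
      (q : Polynomial (MvPolynomial (Fin M) (S → ℝ))) i,
      eval₂Hom (evalAt t w) z (q.eval₂ C (X i)) = (q.map (evalAt t w)).eval (z i) := by
    intro t z w q i
    have : (eval₂Hom (evalAt t w) z).comp C = evalAt t w := by
      ext a <;> simp
    rw [Polynomial.hom_eval₂, this, Polynomial.eval_map, eval₂Hom_X']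
  refine ⟨?_, fun q hq i => ?_⟩
  · funext j
    have h1 := h ((p j).map C - C (X j)) (by simp [graphPolys])
    rw [hev, hev, sub_self, sign_zero, eq_comm, sign_eq_zero_iff, sub_eq_zero] at h1
    exact h1
  · have h1 := h (q.eval₂ C (X i)) (by
      simp only [graphPolys, Finset.coe_union, Finset.coe_image, Set.mem_union, Set.mem_image]
      exact Or.inl ⟨(q, i), by simpa using hq, rfl⟩)
    rwa [hev', hev'] at h1

theorem lift_commutes {F : Finset (Polynomial (MvPolynomial (Fin M) (S → ℝ)))}
    (hf : ∀ s x j, f s x j = evalAt s x (p j)) (hρ : ∀ i, (ρ i).Monic)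
    (hroot : ∀ s x i, ((ρ i).map (evalAt s (f s x))).eval (x i) = 0)
    (hF : ∀ q ∈ F, q.derivative ∈ F) (hρF : ∀ i, ρ i ∈ F) {s s' : S} {x : Fin N → ℝ}
    {y' : Fin M → ℝ} {θ : ℝ ≃o ℝ}
    (hθ : ∀ q ∈ F, SignMatch θ (q.map (evalAt s (f s x))) (q.map (evalAt s' y')))
    (h : ∃ x', SignAgree
      (graphPolys p F : Set (MvPolynomial (Fin N) (MvPolynomial (Fin M) (S → ℝ))))
      (eval₂Hom (evalAt s (f s x)) x) (eval₂Hom (evalAt s' y') x')) :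
    f s' (fun i => θ (x i)) = y' := by
  obtain ⟨x', hx'⟩ := h
  obtain ⟨h1, h2⟩ := exists_signAgree_fiber hf hx'
  rw [← h1]
  congr 1
  funext i
  refine eq_of_weakSign (p := fun q : F => q.1.map (evalAt s' y'))
    (τ := fun q => SignType.sign ((q.1.map (evalAt s (f s x))).eval (x i)))
    (fun q => ⟨⟨_, hF q.1 q.2⟩, Polynomial.derivative_map _ _ |>.symm⟩) (fun q => ?_) (fun q => ?_)
    (i := ⟨ρ i, hρF i⟩) ((hρ i).map _).ne_zero (by simp [hroot])
  · rw [hθ q.1 q.2 (x i)]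
    exact weakSign_sign _
  · rw [h2 q.1 q.2 i]
    exact weakSign_sign _

/-- A family of polynomial maps, uniformly integral over the target, has finitely many topological
types. -/
theorem exists_finite_coloring_of_integral (hf : ∀ s x j, f s x j = evalAt s x (p j))
    (hρ : ∀ i, (ρ i).Monic) (hroot : ∀ s x i, ((ρ i).map (evalAt s (f s x))).eval (x i) = 0) :
    ∃ (α : Type) (_ : Finite α) (χ : S → α), ∀ s s', χ s = χ s' →
      ∃ (Φ : (Fin N → ℝ) ≃ₜ (Fin N → ℝ)) (Ψ : (Fin M → ℝ) ≃ₜ (Fin M → ℝ)),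
        ∀ x, f s' (Φ x) = Ψ (f s x) := by
  classical
  set F := derivClosure (Finset.univ.image ρ)
  have hFd : ∀ q ∈ F, q.derivative ∈ F := fun q hq => derivative_mem_derivClosure hq
  have hρF : ∀ i, ρ i ∈ F := fun i =>
    subset_derivClosure (Finset.mem_image_of_mem _ (Finset.mem_univ i))
  obtain ⟨G₁, hG₁⟩ := exists_eliminates F
  obtain ⟨G₂, hG₂⟩ := exists_eliminates_mv N (graphPolys p F)
  obtain ⟨α, hα, χ, hχ⟩ := exists_finite_coloring M (G₁ ∪ G₂)
  refine ⟨α, hα, χ, fun s s' hs => ?_⟩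
  obtain ⟨h, hh⟩ := hχ s s' hs
  have hgood : ∀ t, GoodFamily fun (q : F) y => q.1.map (evalAt t y) := fun t =>
    goodFamily_derivClosure (continuous_evalAt t) fun q hq x y => by
      obtain ⟨i, -, rfl⟩ := Finset.mem_image.1 hq
      rw [(hρ i).degree_map, (hρ i).degree_map]
  obtain ⟨φ, hφ, hφm⟩ := (hgood s).exists_continuous_signMatch ((hgood s').comp h.continuous)
    fun y => by
      obtain ⟨θ, hθ⟩ := hG₁ _ _ ((hh y).mono (by simp))
      exact ⟨θ, fun q => hθ q.1 q.2⟩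
  have hsymm : ∀ y, SignAgree ((G₁ ∪ G₂ : Finset _) : Set (MvPolynomial (Fin M) (S → ℝ)))
      (evalAt s' y) (evalAt s (h.symm y)) := fun y a ha => by
    have := hh (h.symm y) a ha
    rw [h.apply_symm_apply] at this
    exact this.symm
  have hfc : ∀ t, Continuous (f t) := fun t =>
    continuous_pi fun j => by simpa only [hf] using continuous_evalAt t (p j)
  have hfwd : ∀ x, f s' (fun i => φ (f s x) (x i)) = h (f s x) := fun x =>
    lift_commutes hf hρ hroot hFd hρF (fun q hq => hφm ⟨q, hq⟩ (f s x))
      (hG₂ _ _ ((hh _).mono (by simp)) x)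
  have hbwd : ∀ x, f s (fun i => (φ (h.symm (f s' x))).symm (x i)) = h.symm (f s' x) := fun x =>
    lift_commutes hf hρ hroot hFd hρF (fun q hq => by
      have := (hφm ⟨q, hq⟩ (h.symm (f s' x))).symm
      rwa [h.apply_symm_apply] at this) (hG₂ _ _ ((hsymm _).mono (by simp)) x)
  refine ⟨⟨⟨fun x i => φ (f s x) (x i), fun x i => (φ (h.symm (f s' x))).symm (x i),
    fun x => ?_, fun x => ?_⟩, ?_, ?_⟩, h, hfwd⟩
  · funext i
    simp only [hfwd, h.symm_apply_apply, OrderIso.symm_apply_apply]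
  · funext i
    simp only [hbwd, OrderIso.apply_symm_apply]
  · exact continuous_pi fun i => hφ.comp ((hfc s).prodMk (continuous_apply i))
  · exact continuous_pi fun i => (continuous_uncurry_symm hφ).comp
      ((h.symm.continuous.comp (hfc s')).prodMk (continuous_apply i))

end Lift

/-! ### Rings of functions on a family -/

theorem eval_eq_sum_of_totalDegree_le {R : Type*} [CommSemiring R] {n D : ℕ}
    {Q : MvPolynomial (Fin n) R} (hQ : Q.totalDegree ≤ D) (y : Fin n → R) :
    eval y Q = ∑ d : Fin n → Fin (D + 1),
      Q.coeff (Finsupp.equivFunOnFinite.symm fun i => (d i : ℕ)) * ∏ i, y i ^ (d i : ℕ) := by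
  classical
  let e : (Fin n → Fin (D + 1)) → (Fin n →₀ ℕ) := fun d =>
    Finsupp.equivFunOnFinite.symm fun i => (d i : ℕ)
  have he : Function.Injective e := fun a b h => by
    funext i
    exact Fin.ext (congrFun (Finsupp.equivFunOnFinite.symm.injective h) i)
  rw [eval_eq']
  have hsub : Q.support ⊆ Finset.univ.image e := by
    intro d hd
    have hlt : ∀ i, d i < D + 1 := fun i =>
      Nat.lt_succ_of_le (((monomial_le_degreeOf i hd).trans (degreeOf_le_totalDegree Q i)).trans hQ)
    refine Finset.mem_image.2 ⟨fun i => ⟨d i, hlt i⟩, Finset.mem_univ _, ?_⟩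
    exact Finsupp.equivFunOnFinite.symm_apply_apply d
  rw [Finset.sum_subset hsub fun d _ hd => by rw [notMem_support_iff.1 hd, zero_mul],
    Finset.sum_image he.injOn]
  rfl

/-- A ring of functions on `S × Z` containing all functions of the first variable is closed under
substitution into families of polynomials of bounded degree. -/
theorem eval_mem_subring {S Z : Type*} {A : Subring (S × Z → ℂ)}
    (hA : ∀ a : S → ℂ, (fun z => a z.1) ∈ A) {n D : ℕ} {Q : S → MvPolynomial (Fin n) ℂ}
    (hQ : ∀ s, (Q s).totalDegree ≤ D) {g : Fin n → S × Z → ℂ} (hg : ∀ i, g i ∈ A) :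
    (fun z => eval (fun i => g i z) (Q z.1)) ∈ A := by
  have : (fun z => eval (fun i => g i z) (Q z.1)) = ∑ d : Fin n → Fin (D + 1),
      (fun z : S × Z => (Q z.1).coeff (Finsupp.equivFunOnFinite.symm fun i => (d i : ℕ))) *
        ∏ i, g i ^ (d i : ℕ) := by
    funext z
    rw [eval_eq_sum_of_totalDegree_le (hQ z.1)]
    simp
  rw [this]
  exact sum_mem fun d _ => mul_mem (hA fun s => (Q s).coeff _)
    (prod_mem fun i _ => pow_mem (hg i) _)

/-- Functions whose real and imaginary parts are polynomials. -/
noncomputable def polySubring (S : Type*) (N : ℕ) : Subring (S × (Fin N → ℝ) → ℂ) where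
  carrier := {g | ∃ p q : MvPolynomial (Fin N) (S → ℝ),
    ∀ z, g z = ⟨evalAt z.1 z.2 p, evalAt z.1 z.2 q⟩}
  mul_mem' := by
    rintro a b ⟨p, q, h⟩ ⟨p', q', h'⟩
    refine ⟨p * p' - q * q', p * q' + q * p', fun z => ?_⟩
    rw [Pi.mul_apply, h, h']
    apply Complex.ext <;> simp
  add_mem' := by
    rintro a b ⟨p, q, h⟩ ⟨p', q', h'⟩
    refine ⟨p + p', q + q', fun z => ?_⟩
    rw [Pi.add_apply, h, h']
    apply Complex.ext <;> simp
  neg_mem' := by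
    rintro a ⟨p, q, h⟩
    refine ⟨-p, -q, fun z => ?_⟩
    rw [Pi.neg_apply, h]
    apply Complex.ext <;> simp
  one_mem' := ⟨1, 0, fun z => by apply Complex.ext <;> simp⟩
  zero_mem' := ⟨0, 0, fun z => by apply Complex.ext <;> simp⟩

/-- The elements integral over a ring homomorphism. -/
def integralSubring {R A : Type*} [CommRing R] [CommRing A] (ε : R →+* A) : Subring A where
  carrier := {g | ε.IsIntegralElem g}
  mul_mem' ha hb := RingHom.IsIntegralElem.mul _ ha hb
  add_mem' ha hb := RingHom.IsIntegralElem.add _ ha hb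
  neg_mem' ha := RingHom.IsIntegralElem.neg _ ha
  one_mem' := RingHom.isIntegralElem_one _
  zero_mem' := RingHom.isIntegralElem_zero _

theorem map_mem_integralSubring {R A : Type*} [CommRing R] [CommRing A] (ε : R →+* A) (a : R) :
    ε a ∈ integralSubring ε :=
  RingHom.isIntegralElem_map _

theorem mem_integralSubring_of_relation {R A : Type*} [CommRing R] [CommRing A] (ε : R →+* A)
    {D : ℕ} {a : Fin D → A} (ha : ∀ i, a i ∈ integralSubring ε) {x : A}
    (hx : x ^ D + ∑ i, a i * x ^ (i : ℕ) = 0) : x ∈ integralSubring ε := by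
  let _ := ε.toAlgebra
  have hmem : ∀ i, a i ∈ integralClosure R A := ha
  have : IsIntegral (integralClosure R A) x := by
    refine ⟨Polynomial.X ^ D + ∑ i : Fin D, Polynomial.C ⟨a i, hmem i⟩ * Polynomial.X ^ (i : ℕ),
      Polynomial.monic_X_pow_add ?_, ?_⟩
    · exact Polynomial.degree_sum_fin_lt fun i : Fin D => (⟨a i, hmem i⟩ : integralClosure R A)
    · rw [Polynomial.eval₂_add, Polynomial.eval₂_pow, Polynomial.eval₂_X,
        Polynomial.eval₂_finsetSum]
      simpa [Subalgebra.algebraMap_def] using hx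
  exact isIntegral_trans (R := R) (A := integralClosure R A) x this

theorem mem_integralSubring_of_fixed {R A : Type*} [CommRing R] [CommRing A] {ε : R →+* A}
    {σ : A →+* A} (hσ : σ.comp ε = ε) {x : A} (hx : x ∈ integralSubring ε) :
    σ x ∈ integralSubring ε := by
  obtain ⟨p, hp, h⟩ := hx
  refine ⟨p, hp, ?_⟩
  rw [← hσ, ← Polynomial.hom_eval₂, h, map_zero]

/-- Real coordinates on `ℂ^d`. -/
noncomputable def realCoord (d : ℕ) : (Fin d → ℂ) ≃ₜ (Fin (d * 2) → ℝ) where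
  toFun z i := if (finProdFinEquiv.symm i).2 = 0 then (z (finProdFinEquiv.symm i).1).re
    else (z (finProdFinEquiv.symm i).1).im
  invFun w j := ⟨w (finProdFinEquiv (j, 0)), w (finProdFinEquiv (j, 1))⟩
  left_inv z := by
    funext j
    apply Complex.ext <;> simp
  right_inv w := by
    funext i
    obtain ⟨⟨j, b⟩, rfl⟩ := finProdFinEquiv.surjective i
    fin_cases b <;> simp
  continuous_toFun := by
    refine continuous_pi fun i => ?_
    split_ifs
    · exact Complex.continuous_re.comp (continuous_apply _)
    · exact Complex.continuous_im.comp (continuous_apply _)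
  continuous_invFun := by
    refine continuous_pi fun j => ?_
    have : (fun w : Fin (d * 2) → ℝ => (⟨w (finProdFinEquiv (j, 0)), w (finProdFinEquiv (j, 1))⟩ : ℂ))
        = fun w => (w (finProdFinEquiv (j, 0)) : ℂ) + w (finProdFinEquiv (j, 1)) * Complex.I :=
      _root_.funext fun w => Complex.mk_eq_add_mul_I _ _
    rw [this]
    fun_prop

theorem realCoord_symm_apply {d : ℕ} (w : Fin (d * 2) → ℝ) (j : Fin d) :
    (realCoord d).symm w j = ⟨w (finProdFinEquiv (j, 0)), w (finProdFinEquiv (j, 1))⟩ := rfl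

theorem realCoord_apply_zero {d : ℕ} (z : Fin d → ℂ) (j : Fin d) :
    realCoord d z (finProdFinEquiv (j, 0)) = (z j).re :=
  congrArg Complex.re (congrFun ((realCoord d).symm_apply_apply z) j)

theorem realCoord_apply_one {d : ℕ} (z : Fin d → ℂ) (j : Fin d) :
    realCoord d z (finProdFinEquiv (j, 1)) = (z j).im :=
  congrArg Complex.im (congrFun ((realCoord d).symm_apply_apply z) j)

section Family

variable {S : Type*} {n m k : ℕ}

/-- A family of polynomial maps in real coordinates. -/
noncomputable def realFamily (P : S → Fin m → MvPolynomial (Fin n) ℂ) (s : S)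
    (x : Fin (n * 2) → ℝ) : Fin (m * 2) → ℝ :=
  realCoord m fun b => eval ((realCoord n).symm x) (P s b)

theorem exists_realFamily_eq_evalAt {P : S → Fin m → MvPolynomial (Fin n) ℂ}
    (hP : ∀ s b, (P s b).totalDegree ≤ k) (j : Fin (m * 2)) :
    ∃ p : MvPolynomial (Fin (n * 2)) (S → ℝ), ∀ s x, realFamily P s x j = evalAt s x p := by
  obtain ⟨⟨b, i⟩, rfl⟩ := finProdFinEquiv.surjective j
  obtain ⟨p, q, h⟩ := eval_mem_subring (A := polySubring S (n * 2))
    (fun a => ⟨C fun s => (a s).re, C fun s => (a s).im, fun z => by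
      apply Complex.ext <;> simp [evalAt]⟩)
    (Q := fun s => P s b) (fun s => hP s b)
    (g := fun i z => (realCoord n).symm z.2 i)
    (fun i => ⟨X (finProdFinEquiv (i, 0)), X (finProdFinEquiv (i, 1)), fun z => by
      beta_reduce
      rw [realCoord_symm_apply]
      apply Complex.ext <;> simp [evalAt]⟩)
  fin_cases i
  · exact ⟨p, fun s x => (realCoord_apply_zero _ b).trans (congrArg Complex.re (h (s, x)))⟩
  · exact ⟨q, fun s x => (realCoord_apply_one _ b).trans (congrArg Complex.im (h (s, x)))⟩

theorem exists_realFamily_integral {P : S → Fin m → MvPolynomial (Fin n) ℂ}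
    (hP : ∀ s b, (P s b).totalDegree ≤ k) (hbdd : ∀ s, BoundedFibers (P s)) (i : Fin (n * 2)) :
    ∃ ρ : Polynomial (MvPolynomial (Fin (m * 2)) (S → ℝ)), ρ.Monic ∧
      ∀ s x, (ρ.map (evalAt s (realFamily P s x))).eval (x i) = 0 := by
  obtain ⟨D, hD⟩ := exists_uniform_integral_relation n m k
  choose c q hq hrel using fun s => hD (P s) (hP s) (hbdd s)
  let ε : MvPolynomial (Fin (m * 2)) (S → ℝ) →+* (S × (Fin (n * 2) → ℝ) → ℂ) :=
    RingHom.pi fun z => Complex.ofRealHom.comp (evalAt z.1 (realFamily P z.1 z.2))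
  have hε : ∀ Q z, ε Q z = (evalAt z.1 (realFamily P z.1 z.2) Q : ℂ) := fun _ _ => rfl
  let σ : (S × (Fin (n * 2) → ℝ) → ℂ) →+* (S × (Fin (n * 2) → ℝ) → ℂ) :=
    RingHom.pi fun z => (starRingEnd ℂ).comp (Pi.evalRingHom _ z)
  have hσ : σ.comp ε = ε := by
    refine RingHom.ext fun Q => _root_.funext fun z => ?_
    exact Complex.conj_ofReal _
  have hI : (fun _ => Complex.I) ∈ integralSubring ε := by
    refine ⟨Polynomial.X ^ 2 + 1, by monicity!, ?_⟩
    funext z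
    simp
  have hreal : ∀ a : S → ℝ, (fun z => (a z.1 : ℂ)) ∈ integralSubring ε := fun a => by
    convert map_mem_integralSubring ε (C a) using 1
    funext z
    simp [hε, evalAt]
  have hA : ∀ a : S → ℂ, (fun z => a z.1) ∈ integralSubring ε := fun a => by
    convert add_mem (hreal fun s => (a s).re) (mul_mem (hreal fun s => (a s).im) hI) using 1
    funext z
    exact (Complex.re_add_im _).symm
  have hu : ∀ b, (fun z : S × (Fin (n * 2) → ℝ) => eval ((realCoord n).symm z.2) (P z.1 b)) ∈
      integralSubring ε := fun b => by
    convert add_mem (map_mem_integralSubring ε (X (finProdFinEquiv (b, 0))))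
      (mul_mem (map_mem_integralSubring ε (X (finProdFinEquiv (b, 1)))) hI) using 1
    funext z
    rw [Pi.add_apply, Pi.mul_apply, hε, hε]
    simp only [evalAt, eval₂Hom_X', realFamily]
    rw [realCoord_apply_zero, realCoord_apply_one, Complex.re_add_im]
  have hz : ∀ j, (fun z : S × (Fin (n * 2) → ℝ) => (realCoord n).symm z.2 j) ∈
      integralSubring ε := fun j => by
    refine mem_integralSubring_of_relation ε (D := D)
      (a := fun i z => eval (fun a => ∑ b, c z.1 a b * eval ((realCoord n).symm z.2) (P z.1 b))
        (q z.1 j i)) (fun i => ?_) ?_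
    · refine eval_mem_subring (Q := fun s => q s j i) hA (fun s => hq s j i)
        (g := fun a z => ∑ b, c z.1 a b * eval ((realCoord n).symm z.2) (P z.1 b)) fun a => ?_
      convert sum_mem (S := integralSubring ε) (t := Finset.univ)
        (f := fun b (z : S × (Fin (n * 2) → ℝ)) => c z.1 a b * eval ((realCoord n).symm z.2) (P z.1 b))
        (fun b _ => mul_mem (hA fun s => c s a b) (hu b)) using 1
      funext z
      simp
    · funext z
      simpa using hrel z.1 ((realCoord n).symm z.2) j
  have hx : (fun z : S × (Fin (n * 2) → ℝ) => (z.2 i : ℂ)) ∈ integralSubring ε := by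
    obtain ⟨⟨j, t⟩, rfl⟩ := finProdFinEquiv.surjective i
    have h1 := hz j
    have h2 := mem_integralSubring_of_fixed hσ h1
    fin_cases t
    · convert mul_mem (hA fun _ => 1 / 2) (add_mem h1 h2) using 1
      funext z
      change _ = 1 / 2 * ((realCoord n).symm z.2 j + starRingEnd ℂ ((realCoord n).symm z.2 j))
      rw [Complex.add_conj, realCoord_symm_apply]
      simp
    · convert mul_mem (hA fun _ => 1 / (2 * Complex.I)) (sub_mem h1 h2) using 1
      funext z
      change _ = 1 / (2 * Complex.I) *
        ((realCoord n).symm z.2 j - starRingEnd ℂ ((realCoord n).symm z.2 j))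
      rw [Complex.sub_conj, realCoord_symm_apply]
      have := Complex.I_ne_zero
      simp
      field_simp
      simp
  obtain ⟨ρ, hρ, h⟩ := hx
  refine ⟨ρ, hρ, fun s x => ?_⟩
  have h1 := congrFun h (s, x)
  have h2 := Polynomial.hom_eval₂ ρ ε (Pi.evalRingHom (fun _ => ℂ) (s, x))
    (fun z : S × (Fin (n * 2) → ℝ) => (z.2 i : ℂ))
  have h3 : (Pi.evalRingHom (fun _ => ℂ) (s, x)).comp ε =
      Complex.ofRealHom.comp (evalAt s (realFamily P s x)) := rfl
  have h4 := Polynomial.hom_eval₂ ρ (evalAt s (realFamily P s x)) Complex.ofRealHom (x i)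
  rw [h3] at h2
  rw [Polynomial.eval_map]
  exact Complex.ofReal_injective (h4.trans (h2.symm.trans h1))

end Family

theorem boundedFibers_of_proper {n m : ℕ} {P : Fin m → MvPolynomial (Fin n) ℂ}
    (h : ∀ K : Set (Fin m → ℂ), IsCompact K → IsCompact ((fun x i => eval x (P i)) ⁻¹' K)) :
    BoundedFibers P := fun M => by
  obtain ⟨M', hM'⟩ := (h _ (isCompact_closedBall 0 M)).isBounded.exists_norm_le
  exact ⟨M', fun x hx => hM' x (mem_closedBall_zero_iff.2 hx)⟩

theorem finitely_many_topTypes_proper_polynomial_maps (n m k : ℕ)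
    (hn : 0 < n) (hm : 0 < m) (hk : 0 < k) :
    ∃ S : Set ((Fin n → ℂ) → (Fin m → ℂ)), S.Finite ∧
      ∀ f : (Fin n → ℂ) → (Fin m → ℂ),
        (∃ P : Fin m → MvPolynomial (Fin n) ℂ,
          (∀ i, (P i).totalDegree ≤ k) ∧ ∀ x i, f x i = eval x (P i)) →
        (∀ K : Set (Fin m → ℂ), IsCompact K → IsCompact (f ⁻¹' K)) →
        ∃ g ∈ S, ∃ (Φ : (Fin n → ℂ) ≃ₜ (Fin n → ℂ)) (Ψ : (Fin m → ℂ) ≃ₜ (Fin m → ℂ)),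
          ∀ x, Ψ (f (Φ x)) = g x := by
  let S := {P : Fin m → MvPolynomial (Fin n) ℂ //
    (∀ i, (P i).totalDegree ≤ k) ∧ BoundedFibers P}
  choose p hp using exists_realFamily_eq_evalAt (P := fun s : S => s.1) fun s => s.2.1
  choose ρ hρ hroot using exists_realFamily_integral (P := fun s : S => s.1)
    (fun s => s.2.1) fun s => s.2.2
  obtain ⟨α, hα, χ, hχ⟩ := exists_finite_coloring_of_integral
    (fun s x j => hp j s x) hρ fun s x i => hroot i s x
  let toMap : S → (Fin n → ℂ) → (Fin m → ℂ) := fun s x i => eval x (s.1 i)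
  refine ⟨Set.range fun a : Set.range χ => toMap a.2.choose, Set.finite_range _, ?_⟩
  rintro f ⟨P, hdeg, hfP⟩ hproper
  obtain rfl : f = fun x i => eval x (P i) := _root_.funext fun x => _root_.funext fun i => hfP x i
  let s : S := ⟨P, hdeg, boundedFibers_of_proper hproper⟩
  let a : Set.range χ := ⟨χ s, s, rfl⟩
  refine ⟨_, ⟨a, rfl⟩, ?_⟩
  obtain ⟨Φ, Ψ, h⟩ := hχ _ _ a.2.choose_spec
  refine ⟨((realCoord n).trans Φ).trans (realCoord n).symm,
    ((realCoord m).trans Ψ.symm).trans (realCoord m).symm, fun x => ?_⟩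
  have h1 := h (realCoord n x)
  simp only [realFamily, Homeomorph.symm_apply_apply] at h1
  simp only [Homeomorph.trans_apply]
  rw [Homeomorph.symm_apply_eq, Homeomorph.symm_apply_eq]
  exact h1
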